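/- Let p be a prime with p ≥ 5 and k an even integer, and let K = Q(√-3). If f ∈ M_k^{(s)}(U_2(O_K), ν_k)_Q satisfies a_f([[m, α],[ᾱ, n]]) = 0 for all integers m, n and all α ∈ D_K^{-1} with 0 ≤ m ≤ (5k+9)/45, 0 ≤ n ≤ (10k+3)/90 and mn − N(α) ≥ 0, then f = 0 identically. -/

import Mathlib

open Complex Matrix
open scoped ComplexOrder

noncomputable section

/-- `√d_K` for an imaginary quadratic discriminant `d < 0`,
taken as `√|d| · i` in the upper half plane. -/
def sqrtD (d : ℤ) : ℂ := Real.sqrt (-d) * Complex.I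

/-- The ring of integers `O_K = ℤ[(d + √d)/2]` of the imaginary quadratic field of
discriminant `d`, viewed as a subset of `ℂ`. -/
def ringInt (d : ℤ) : Set ℂ :=
  {z | ∃ a b : ℤ, z = (a : ℂ) + (b : ℂ) * (((d : ℂ) + sqrtD d) / 2)}

/-- The inverse different `D_K⁻¹ = O_K / √d_K`. -/
def invDiff (d : ℤ) : Set ℂ := {z | sqrtD d * z ∈ ringInt d}

/-- The Hermitian upper half-space of degree 2:
`Z` with `(Z - ᵗZ̄)/(2i)` positive definite. -/
def HermitianUpperHalfSpace : Set (Matrix (Fin 2) (Fin 2) ℂ) :=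
  {Z | ((Z - Zᴴ).map (fun w => w / (2 * Complex.I))).PosDef}

/-- The lattice `Λ₂(K)`: Hermitian matrices with integral diagonal and
`√d_K ·`(off-diagonal entries) in `O_K`. -/
def LambdaH (d : ℤ) : Set (Matrix (Fin 2) (Fin 2) ℂ) :=
  {H | H.IsHermitian ∧ (∀ i, ∃ n : ℤ, H i i = (n : ℂ)) ∧
    ∀ i j, sqrtD d * H i j ∈ ringInt d}

/-- Semi-positive elements of `Λ₂(K)`, the index set of Fourier expansions. -/
def HermLattice (d : ℤ) : Set (Matrix (Fin 2) (Fin 2) ℂ) :=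
  {H | H ∈ LambdaH d ∧ H.PosSemidef}

/-- The symplectic-form matrix `J₂ = [[0, -1], [1, 0]]` (2×2 blocks). -/
def J2 : Matrix (Fin 2 ⊕ Fin 2) (Fin 2 ⊕ Fin 2) ℂ :=
  Matrix.fromBlocks 0 (-1) 1 0

/-- The Hermitian modular group `U₂(O_K)`:
matrices with entries in `O_K` satisfying `ᵗM̄ J₂ M = J₂`. -/
def HermitianModularGroup (d : ℤ) : Set (Matrix (Fin 2 ⊕ Fin 2) (Fin 2 ⊕ Fin 2) ℂ) :=
  {M | (∀ i j, M i j ∈ ringInt d) ∧ Mᴴ * J2 * M = J2}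

/-- The fractional-linear action `Z ↦ (AZ + B)(CZ + D)⁻¹`. -/
def matAct (M : Matrix (Fin 2 ⊕ Fin 2) (Fin 2 ⊕ Fin 2) ℂ)
    (Z : Matrix (Fin 2) (Fin 2) ℂ) : Matrix (Fin 2) (Fin 2) ℂ :=
  (M.toBlocks₁₁ * Z + M.toBlocks₁₂) * (M.toBlocks₂₁ * Z + M.toBlocks₂₂)⁻¹

/-- The character `ν_k`: `det^{k/2}` for `K = ℚ(√-1)` (i.e. `d = -4`, `k` even),
and `det^k` for `K = ℚ(√-3)` (i.e. `d = -3`). -/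
def nuChar (d k : ℤ) (M : Matrix (Fin 2 ⊕ Fin 2) (Fin 2 ⊕ Fin 2) ℂ) : ℂ :=
  if d = -4 then M.det ^ (k / 2) else M.det ^ k

/-- A Hermitian modular form of degree 2, weight `k` and character `ν_k` for `U₂(O_K)`,
bundled with its Fourier expansion over the semi-positive part of `Λ₂(K)`. -/
structure HermitianModularForm (d k : ℤ) where
  toFun : Matrix (Fin 2) (Fin 2) ℂ → ℂ
  coeff : Matrix (Fin 2) (Fin 2) ℂ → ℂ
  holo : DifferentiableOn ℂ (fun Z : Fin 2 → Fin 2 → ℂ => toFun (Matrix.of Z))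
    {Z | Matrix.of Z ∈ HermitianUpperHalfSpace}
  transform : ∀ M ∈ HermitianModularGroup d, ∀ Z ∈ HermitianUpperHalfSpace,
    toFun (matAct M Z) =
      nuChar d k M * (M.toBlocks₂₁ * Z + M.toBlocks₂₂).det ^ k * toFun Z
  coeff_supported : ∀ H, coeff H ≠ 0 → H ∈ HermLattice d
  expansion : ∀ Z ∈ HermitianUpperHalfSpace,
    HasSum (fun H : HermLattice d =>
      coeff H * Complex.exp (2 * Real.pi * Complex.I * ((H : Matrix (Fin 2) (Fin 2) ℂ) * Z).trace))
      (toFun Z)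

/-- A Hermitian modular form is symmetric if `f(ᵗZ) = f(Z)`. -/
def IsSymmetricHMF {d k : ℤ} (f : HermitianModularForm d k) : Prop :=
  ∀ Z ∈ HermitianUpperHalfSpace, f.toFun Zᵀ = f.toFun Z

/-- `z` is a `p`-integral rational number: `z = a/b` with `p ∤ b`. -/
def IsPIntegral (p : ℕ) (z : ℂ) : Prop :=
  ∃ a b : ℤ, ¬ (p : ℤ) ∣ b ∧ (b : ℂ) * z = (a : ℂ)

/-- `z ≡ w (mod p^l)` in the local ring `ℤ_(p)`, i.e. `(z - w)/p^l` is `p`-integral. -/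
def ModCongr (p l : ℕ) (z w : ℂ) : Prop :=
  IsPIntegral p ((z - w) / (p : ℂ) ^ l)


/-- The lexicographic order on `Λ₂(K)` used to define `ord_p`:
compare first `tr H`, then the `(1,1)`-entry `m`, then (for off-diagonal entry
`(a + b i)/2`) first `a`, then `b`. -/
def lexLt (H H' : Matrix (Fin 2) (Fin 2) ℂ) : Prop :=
  H.trace.re < H'.trace.re ∨
    (H.trace = H'.trace ∧
      ((H 0 0).re < (H' 0 0).re ∨
        (H 0 0 = H' 0 0 ∧
          ((H 0 1).re < (H' 0 1).re ∨
            ((H 0 1).re = (H' 0 1).re ∧ (H 0 1).im < (H' 0 1).im)))))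

/-- The Siegel upper half-space of degree `n`: symmetric complex matrices with
positive definite imaginary part. -/
def SiegelUpperHalfSpace (n : ℕ) : Set (Matrix (Fin n) (Fin n) ℂ) :=
  {Z | Z.IsSymm ∧ ((Z - Zᴴ).map (fun w => w / (2 * Complex.I))).PosDef}

/-- The symplectic-form matrix over `ℤ` in degree `n`. -/
def Jn (n : ℕ) : Matrix (Fin n ⊕ Fin n) (Fin n ⊕ Fin n) ℤ :=
  Matrix.fromBlocks 0 (-1) 1 0

/-- The Siegel modular group `Γ_n = Sp_n(ℤ)` (as a set of `2n × 2n` integer matrices). -/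
def SiegelModularGroup (n : ℕ) : Set (Matrix (Fin n ⊕ Fin n) (Fin n ⊕ Fin n) ℤ) :=
  {M | Mᵀ * Jn n * M = Jn n}

/-- The fractional-linear action of an integral symplectic matrix on the Siegel
upper half-space. -/
def matActS {n : ℕ} (M : Matrix (Fin n ⊕ Fin n) (Fin n ⊕ Fin n) ℤ)
    (Z : Matrix (Fin n) (Fin n) ℂ) : Matrix (Fin n) (Fin n) ℂ :=
  ((M.map (fun a => (a : ℂ))).toBlocks₁₁ * Z + (M.map (fun a => (a : ℂ))).toBlocks₁₂) *
    ((M.map (fun a => (a : ℂ))).toBlocks₂₁ * Z + (M.map (fun a => (a : ℂ))).toBlocks₂₂)⁻¹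

/-- The index lattice of Fourier expansions of Siegel modular forms of level `N`:
semi-positive symmetric rational matrices `T` with `N·T` half-integral,
i.e. `T ∈ (1/N)Λ_n`. -/
def SiegelLattice (n : ℕ) (N : ℕ) : Set (Matrix (Fin n) (Fin n) ℚ) :=
  {T | T.IsSymm ∧ (∀ i, ∃ a : ℤ, (N : ℚ) * T i i = (a : ℚ)) ∧
    (∀ i j, ∃ a : ℤ, 2 * (N : ℚ) * T i j = (a : ℚ)) ∧
    (T.map (fun q => (q : ℝ))).PosSemidef}

/-- A Siegel modular form of degree `n` and weight `k` for a subgroup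
`Γ ⊆ Γ_n = Sp_n(ℤ)` of level `N`, bundled with its Fourier expansion. For the
full modular group take `Γ = SiegelModularGroup n` and `N = 1`. -/
structure SiegelModularForm (n : ℕ) (k : ℤ)
    (Γ : Set (Matrix (Fin n ⊕ Fin n) (Fin n ⊕ Fin n) ℤ)) (N : ℕ) where
  toFun : Matrix (Fin n) (Fin n) ℂ → ℂ
  coeff : Matrix (Fin n) (Fin n) ℚ → ℂ
  holo : DifferentiableOn ℂ (fun Z : Fin n → Fin n → ℂ => toFun (Matrix.of Z))
    {Z | Matrix.of Z ∈ SiegelUpperHalfSpace n}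
  transform : ∀ M ∈ Γ, ∀ Z ∈ SiegelUpperHalfSpace n,
    toFun (matActS M Z) =
      ((M.map (fun a => (a : ℂ))).toBlocks₂₁ * Z +
        (M.map (fun a => (a : ℂ))).toBlocks₂₂).det ^ k * toFun Z
  coeff_supported : ∀ T, coeff T ≠ 0 → T ∈ SiegelLattice n N
  expansion : ∀ Z ∈ SiegelUpperHalfSpace n,
    HasSum (fun T : SiegelLattice n N =>
      coeff T * Complex.exp (2 * Real.pi * Complex.I *
        (((T : Matrix (Fin n) (Fin n) ℚ).map (fun q => (q : ℂ))) * Z).trace))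
      (toFun Z)


/-- A Hermitian cusp form (degree 2, class number one field): the Fourier
coefficients vanish off the positive definite part of the lattice. -/
def IsCuspHMF {d k : ℤ} (f : HermitianModularForm d k) : Prop :=
  ∀ H, ¬ H.PosDef → f.coeff H = 0

/-- `H0 = ord_p f`: `H0` is the minimal element of `Λ₂(K)`, in the lexicographic
order `lexLt`, whose Fourier coefficient is not divisible by `p`. -/
def IsOrdP (p : ℕ) {d k : ℤ} (f : HermitianModularForm d k)
    (H0 : Matrix (Fin 2) (Fin 2) ℂ) : Prop :=
  H0 ∈ HermLattice d ∧ ¬ ModCongr p 1 (f.coeff H0) 0 ∧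
    ∀ H ∈ HermLattice d, lexLt H H0 → ModCongr p 1 (f.coeff H) 0

/-- If all power moments of `B` along linear forms vanish in degree `j`, so do all its monomial
moments of degree `j`. -/
lemma monomial_moment_eq_zero {T : Finset (ℤ × ℤ)} {B : ℤ × ℤ → ℂ} {j : ℕ}
    (h : ∀ v₁ v₂ : ℂ, ∑ p ∈ T, B p * (p.1 * v₁ + p.2 * v₂) ^ j = 0) {a b : ℕ} (hab : a + b = j) :
    ∑ p ∈ T, B p * ((p.1 : ℂ) ^ a * (p.2 : ℂ) ^ b) = 0 := by
  let P : Polynomial ℂ := ∑ p ∈ T, Polynomial.C (B p) *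
    (Polynomial.C (p.2 : ℂ) * Polynomial.X + Polynomial.C (p.1 : ℂ)) ^ j
  have hP : P = 0 := by
    refine Polynomial.funext fun s => ?_
    rw [Polynomial.eval_zero, ← h 1 s, Polynomial.eval_finsetSum]
    refine Finset.sum_congr rfl fun p _ => ?_
    simp only [Polynomial.eval_mul, Polynomial.eval_pow, Polynomial.eval_add, Polynomial.eval_C,
      Polynomial.eval_X]
    ring
  have hc : P.coeff b = 0 := by rw [hP, Polynomial.coeff_zero]
  have hcoeff : P.coeff b =
      (j.choose b : ℂ) * ∑ p ∈ T, B p * ((p.1 : ℂ) ^ a * (p.2 : ℂ) ^ b) := by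
    rw [Polynomial.finsetSum_coeff, Finset.mul_sum]
    refine Finset.sum_congr rfl fun p _ => ?_
    rw [Polynomial.coeff_C_mul, add_pow, Polynomial.finsetSum_coeff,
      Finset.sum_eq_single b]
    · rw [mul_pow, ← Polynomial.C_pow, ← Polynomial.C_pow,
        show j - b = a by omega, show (j.choose b : Polynomial ℂ) = Polynomial.C (j.choose b : ℂ) by
          simp, Polynomial.coeff_mul_C, Polynomial.coeff_mul_C, Polynomial.coeff_C_mul,
        Polynomial.coeff_X_pow_self]
      ring
    · intro r _ hr
      rw [mul_pow, ← Polynomial.C_pow, ← Polynomial.C_pow,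
        show (j.choose r : Polynomial ℂ) = Polynomial.C (j.choose r : ℂ) by
          simp, Polynomial.coeff_mul_C, Polynomial.coeff_mul_C, Polynomial.coeff_C_mul,
        Polynomial.coeff_X_pow, if_neg (Ne.symm hr)]
      ring
    · intro hb
      exact absurd (Finset.mem_range.mpr (by omega)) hb
  rw [hcoeff] at hc
  exact (mul_eq_zero.mp hc).resolve_left
    (Nat.cast_ne_zero.mpr (Nat.choose_pos (by omega)).ne')

/-- Multiplying by a product of affine functions lowers the degree up to which the moments
vanish by the number of factors. -/
lemma sum_mul_affine_prod_eq_zero {T : Finset (ℤ × ℤ)} (L : List (ℂ × ℂ × ℂ)) :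
    ∀ {B : ℤ × ℤ → ℂ},
      (∀ a b : ℕ, a + b ≤ L.length → ∑ p ∈ T, B p * ((p.1 : ℂ) ^ a * (p.2 : ℂ) ^ b) = 0) →
      ∑ p ∈ T, B p * (L.map fun l => l.1 * (p.1 : ℂ) + l.2.1 * (p.2 : ℂ) + l.2.2).prod = 0 := by
  induction L with
  | nil =>
    intro B h
    simpa using h 0 0 le_rfl
  | cons l L ih =>
    intro B h
    have := ih (B := fun p => B p * (l.1 * p.1 + l.2.1 * p.2 + l.2.2)) (fun a b hab => by
      have h1 := h (a + 1) b (by simp; omega)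
      have h2 := h a (b + 1) (by simp; omega)
      have h3 := h a b (by simp; omega)
      calc _ = l.1 * ∑ p ∈ T, B p * ((p.1 : ℂ) ^ (a + 1) * (p.2 : ℂ) ^ b)
            + l.2.1 * ∑ p ∈ T, B p * ((p.1 : ℂ) ^ a * (p.2 : ℂ) ^ (b + 1))
            + l.2.2 * ∑ p ∈ T, B p * ((p.1 : ℂ) ^ a * (p.2 : ℂ) ^ b) := by
              simp only [Finset.mul_sum, ← Finset.sum_add_distrib]
              exact Finset.sum_congr rfl fun p _ => by ring
        _ = 0 := by rw [h1, h2, h3]; ring)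
    rw [← this]
    refine Finset.sum_congr rfl fun p _ => ?_
    rw [List.map_cons, List.prod_cons]
    ring

/-- A function on the lattice points of the hexagon `|x|, |y|, |x + y| ≤ m` is determined by its
moments of degree at most `3 m`. -/
lemma eq_zero_of_moments_hexagon {T : Finset (ℤ × ℤ)} {B : ℤ × ℤ → ℂ} (m : ℕ)
    (hsupp : ∀ p, B p ≠ 0 → p ∈ T ∧ |p.1| ≤ m ∧ |p.2| ≤ m ∧ |p.1 + p.2| ≤ m)
    (h : ∀ j ≤ 3 * m, ∀ v₁ v₂ : ℂ, ∑ p ∈ T, B p * (p.1 * v₁ + p.2 * v₂) ^ j = 0) : B = 0 := by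
  by_contra hB
  obtain ⟨p₀, hp₀⟩ := Function.ne_iff.mp hB
  obtain ⟨hT, hx, hy, hw⟩ := hsupp p₀ hp₀
  rw [abs_le] at hx hy hw
  -- lines parallel to the sides of the hexagon covering every lattice point except `p₀`
  let Lx : List (ℂ × ℂ × ℂ) :=
    (List.range (m - p₀.1).toNat).map fun c : ℕ => (1, 0, -((p₀.1 + 1 + c : ℤ) : ℂ))
  let Ly : List (ℂ × ℂ × ℂ) :=
    (List.range (m - p₀.2).toNat).map fun c : ℕ => (0, 1, -((p₀.2 + 1 + c : ℤ) : ℂ))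
  let Lw : List (ℂ × ℂ × ℂ) :=
    (List.range (m + (p₀.1 + p₀.2)).toNat).map fun c : ℕ =>
      (-1, -1, -((-(p₀.1 + p₀.2) + 1 + c : ℤ) : ℂ))
  have hlen : (Lx ++ Ly ++ Lw).length = 3 * m := by
    simp only [Lx, Ly, Lw, List.length_append, List.length_map, List.length_range]
    omega
  have key := sum_mul_affine_prod_eq_zero (T := T) (B := B) (Lx ++ Ly ++ Lw) (fun a b hab =>
    monomial_moment_eq_zero (h (a + b) (hlen ▸ hab)) rfl)
  rw [Finset.sum_eq_single p₀] at key
  · rcases mul_eq_zero.mp key with h0 | h0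
    · exact hp₀ h0
    · rw [List.prod_eq_zero_iff] at h0
      simp only [Lx, Ly, Lw, List.map_append, List.map_map, List.mem_append, List.mem_map,
        List.mem_range, Function.comp] at h0
      rcases h0 with (⟨c, -, hc⟩ | ⟨c, -, hc⟩) | ⟨c, -, hc⟩
      all_goals
        norm_num at hc
        ring_nf at hc
        norm_cast at hc
        omega
  · intro p _ hne
    by_cases hBp : B p = 0
    · rw [hBp, zero_mul]
    obtain ⟨-, hx', hy', hw'⟩ := hsupp p hBp
    rw [abs_le] at hx' hy' hw'
    have hcase : p₀.1 < p.1 ∨ p₀.2 < p.2 ∨ p.1 + p.2 < p₀.1 + p₀.2 := by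
      by_contra hcon
      push Not at hcon
      exact hne (Prod.ext (by omega) (by omega))
    have : ((Lx ++ Ly ++ Lw).map fun l => l.1 * (p.1 : ℂ) + l.2.1 * p.2 + l.2.2).prod = 0 := by
      rw [List.prod_eq_zero_iff]
      simp only [Lx, Ly, Lw, List.map_append, List.map_map, List.mem_append, List.mem_map,
        List.mem_range, Function.comp]
      rcases hcase with hc | hc | hc
      · refine Or.inl (Or.inl ⟨(p.1 - p₀.1 - 1).toNat, by omega, ?_⟩)
        rw [show p₀.1 + 1 + ((p.1 - p₀.1 - 1).toNat : ℤ) = p.1 by omega]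
        ring
      · refine Or.inl (Or.inr ⟨(p.2 - p₀.2 - 1).toNat, by omega, ?_⟩)
        rw [show p₀.2 + 1 + ((p.2 - p₀.2 - 1).toNat : ℤ) = p.2 by omega]
        ring
      · refine Or.inr ⟨(p₀.1 + p₀.2 - (p.1 + p.2) - 1).toNat, by omega, ?_⟩
        rw [show -(p₀.1 + p₀.2) + 1 + ((p₀.1 + p₀.2 - (p.1 + p.2) - 1).toNat : ℤ)
          = -(p.1 + p.2) by omega]
        push_cast
        ring
    rw [this, mul_zero]
  · exact fun h => absurd hT h

/-- The additive character `z ↦ exp (2πiz)`. -/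
def expTwoPiI (z : ℂ) : ℂ := Complex.exp (2 * Real.pi * Complex.I * z)

lemma expTwoPiI_add (z w : ℂ) : expTwoPiI (z + w) = expTwoPiI z * expTwoPiI w := by
  rw [expTwoPiI, expTwoPiI, expTwoPiI, mul_add, Complex.exp_add]

lemma expTwoPiI_ne_zero (z : ℂ) : expTwoPiI z ≠ 0 := Complex.exp_ne_zero _

lemma norm_expTwoPiI (z : ℂ) : ‖expTwoPiI z‖ = Real.exp (-(2 * Real.pi) * z.im) := by
  rw [expTwoPiI, Complex.norm_exp]
  congr 1
  simp

lemma norm_expTwoPiI_intCast_mul_ofReal (n : ℤ) (t : ℝ) : ‖expTwoPiI (n * t)‖ = 1 := by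
  rw [norm_expTwoPiI]
  simp

lemma expTwoPiI_intCast (n : ℤ) : expTwoPiI n = 1 := by
  rw [expTwoPiI, Complex.exp_eq_one_iff]
  exact ⟨n, by ring⟩

lemma continuous_expTwoPiI : Continuous expTwoPiI := by
  unfold expTwoPiI
  fun_prop

lemma integral_expTwoPiI_intCast_mul (n : ℤ) :
    ∫ t in (0 : ℝ)..1, expTwoPiI (n * t) = if n = 0 then 1 else 0 := by
  split_ifs with hn
  · simp [hn, expTwoPiI]
  · have hc : (2 * Real.pi * Complex.I * n : ℂ) ≠ 0 := by
      simp [Real.pi_ne_zero, hn]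
    have := integral_exp_mul_complex (a := 0) (b := 1) hc
    have h1 : Complex.exp (2 * Real.pi * Complex.I * n) = 1 := expTwoPiI_intCast n
    simp only [expTwoPiI, ← mul_assoc]
    rw [this]
    simp [h1]

/-- The Fourier coefficients of an absolutely convergent trigonometric series that vanishes
identically are zero. -/
lemma tsum_fiber_eq_zero {ι : Type*} [Countable ι] {b : ι → ℂ} (hb : Summable b) (φ : ι → ℤ)
    (h : ∀ t : ℝ, ∑' i, b i * expTwoPiI (φ i * t) = 0) (n : ℤ) :
    ∑' i, (if φ i = n then b i else 0) = 0 := by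
  let F : ι → C(ℝ, ℂ) := fun i =>
    ⟨fun t => b i * expTwoPiI (((φ i - n : ℤ) : ℂ) * t), by
      have := continuous_expTwoPiI
      fun_prop⟩
  have hnorm : ∀ i, ‖(F i).restrict (⟨Set.uIcc (0 : ℝ) 1, isCompact_uIcc⟩ :
      TopologicalSpace.Compacts ℝ)‖ ≤ ‖b i‖ := by
    intro i
    rw [ContinuousMap.norm_le _ (norm_nonneg _)]
    intro t
    simp only [F, ContinuousMap.restrict_apply, ContinuousMap.coe_mk, norm_mul]
    rw [norm_expTwoPiI_intCast_mul_ofReal, mul_one]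
  have hsum := intervalIntegral.hasSum_intervalIntegral_of_summable_norm (a := 0) (b := 1) (f := F)
    (hb.norm.of_nonneg_of_le (fun _ => norm_nonneg _) hnorm)
  have hterm : ∀ i, ∫ t in (0 : ℝ)..1, F i t = if φ i = n then b i else 0 := by
    intro i
    simp only [F, ContinuousMap.coe_mk]
    rw [intervalIntegral.integral_const_mul, integral_expTwoPiI_intCast_mul]
    simp [sub_eq_zero]
  have hzero : ∀ t : ℝ, ∑' i, F i t = 0 := by
    intro t
    have : ∀ i, F i t = expTwoPiI ((-n : ℤ) * t) * (b i * expTwoPiI (φ i * t)) := by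
      intro i
      simp only [F, ContinuousMap.coe_mk]
      rw [show (((φ i - n : ℤ) : ℂ) * t) = φ i * t + (-n : ℤ) * t by push_cast; ring,
        expTwoPiI_add]
      ring
    simp_rw [this]
    rw [tsum_mul_left, h t, mul_zero]
  simp_rw [hterm, hzero] at hsum
  simpa using hsum.tsum_eq

open UpperHalfPlane MatrixGroups ModularForm in
/-- The Sturm bound for level one, phrased for a `q`-series with the modular transformation law
under `τ ↦ -1/τ`. -/
lemma coeff_eq_zero_of_transform_of_sturm {c : ℕ → ℂ} {w : ℤ}
    (hc : ∀ τ : ℂ, 0 < τ.im → Summable fun m : ℕ => c m * expTwoPiI (m * τ))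
    (hS : ∀ τ : ℂ, 0 < τ.im →
      ∑' m : ℕ, c m * expTwoPiI (m * (-1 / τ)) = τ ^ w * ∑' m : ℕ, c m * expTwoPiI (m * τ))
    (h0 : ∀ m : ℕ, 12 * (m : ℤ) ≤ w → c m = 0) : c = 0 := by
  let g : ℂ → ℂ := fun τ => ∑' m : ℕ, c m * expTwoPiI (m * τ)
  let G : ℍ → ℂ := fun τ => g τ
  have hq : ∀ (τ : ℍ) (m : ℕ), c m • Function.Periodic.qParam 1 τ ^ m
      = c m * expTwoPiI (m * τ) := by
    intro τ m
    rw [smul_eq_mul, Function.Periodic.qParam, ← Complex.exp_nat_mul, expTwoPiI]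
    congr 2
    push_cast
    ring
  have hsum : ∀ τ : ℍ, HasSum (fun m => c m • Function.Periodic.qParam 1 τ ^ m) (G τ) := by
    intro τ
    simp_rw [hq]
    exact (hc τ τ.im_pos).hasSum
  have hdiff : DifferentiableOn ℂ g {z | 0 < z.im} := by
    intro z₀ hz₀
    have hz₀' : 0 < z₀.im := hz₀
    have hopen : IsOpen {z : ℂ | z₀.im / 2 < z.im} :=
      isOpen_lt continuous_const Complex.continuous_im
    have him : (((z₀.im / 2 : ℝ) : ℂ) * Complex.I).im = z₀.im / 2 := by simp
    have hD : DifferentiableOn ℂ g {z : ℂ | z₀.im / 2 < z.im} := by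
      refine differentiableOn_tsum_of_summable_norm
        (hc (((z₀.im / 2 : ℝ) : ℂ) * Complex.I) (by rw [him]; linarith)).norm ?_ hopen ?_
      · intro m
        unfold expTwoPiI
        fun_prop
      · intro m z hz
        rw [norm_mul, norm_mul, norm_expTwoPiI, norm_expTwoPiI]
        refine mul_le_mul_of_nonneg_left (Real.exp_le_exp.mpr ?_) (norm_nonneg _)
        have h1 : ((m : ℂ) * z).im = m * z.im := by simp
        have h2 : ((m : ℂ) * (((z₀.im / 2 : ℝ) : ℂ) * Complex.I)).im = m * (z₀.im / 2) := by
          simp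
        rw [h1, h2]
        have h3 : (m : ℝ) * (z₀.im / 2) ≤ m * z.im :=
          mul_le_mul_of_nonneg_left (le_of_lt hz) (Nat.cast_nonneg m)
        nlinarith [Real.pi_pos]
    have hmem : z₀.im / 2 < z₀.im := by linarith
    exact (hD.differentiableAt (hopen.mem_nhds hmem)).differentiableWithinAt
  have hGS : G ∣[w] ModularGroup.S = G := by
    ext τ
    rw [SlashInvariantForm.slash_S_apply]
    have h1 := hS τ τ.im_pos
    have hτ : (τ : ℂ) ≠ 0 := τ.ne_zero
    have h2 : G (UpperHalfPlane.mk (-τ : ℂ)⁻¹ τ.im_inv_neg_coe_pos) = g (-1 / τ) := by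
      simp only [G]
      congr 1
      rw [inv_neg, neg_div, one_div]
    rw [h2]
    change g (-1 / τ) * _ = g τ
    change g (-1 / τ) = τ ^ w * g τ at h1
    rw [h1, mul_right_comm, ← zpow_add₀ hτ, add_neg_cancel, zpow_zero, one_mul]
  have hGT : G ∣[w] ModularGroup.T = G := by
    ext τ
    have hden : denom (ModularGroup.T : GL (Fin 2) ℝ) τ = 1 := by
      rw [ModularGroup.denom_apply]
      simp [ModularGroup.T]
    rw [SL_slash_apply, modular_T_smul, hden, _root_.one_zpow, mul_one]
    simp only [G, g]
    refine tsum_congr fun m => ?_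
    rw [UpperHalfPlane.coe_vadd, mul_add, expTwoPiI_add]
    have : expTwoPiI ((m : ℂ) * ((1 : ℝ) : ℂ)) = 1 := by
      simpa using expTwoPiI_intCast m
    rw [this, one_mul]
  have hGγ := SlashInvariantForm.slash_action_generators_SL2Z hGS hGT
  let f : ModularForm 𝒮ℒ w :=
    { toFun := G
      slash_action_eq' := by
        rintro A ⟨A, rfl⟩
        exact hGγ A
      holo' := by
        rw [UpperHalfPlane.mdifferentiable_iff]
        refine hdiff.congr fun z hz => ?_
        simp [G, ofComplex_apply_of_im_pos hz]
      bdd_at_cusps' := by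
        intro c hc
        rw [Subgroup.IsArithmetic.isCusp_iff_isCusp_SL2Z] at hc
        rw [OnePoint.isBoundedAt_iff_forall_SL2Z hc]
        intro γ _
        rw [hGγ]
        exact isBoundedAtImInfty_of_hasSum_qExpansion one_pos hsum }
  have hcoeff : ∀ m, c m = (qExpansion 1 f).coeff m := fun m =>
    ModularFormClass.qExpansion_coeff_unique (f := f) one_pos one_mem_strictPeriods_SL hsum m
  have hf : f = 0 := by
    rcases lt_or_ge w 0 with hw | hw
    · exact rank_zero_iff_forall_zero.mp (ModularForm.levelOne_neg_weight_rank_zero hw) f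
    refine ModularForm.sturm_bound_levelOne (lt_of_lt_of_le (b := ((w.toNat / 12 + 1 : ℕ) : ℕ∞))
      (by exact_mod_cast Nat.lt_succ_self _) (PowerSeries.nat_le_order _ _ fun m hm => ?_))
    rw [← hcoeff]
    exact h0 m (by omega)
  funext m
  rw [hcoeff, hf]
  simp [qExpansion_zero]

/-- The Fourier series `∑ A(m,n;x,y) e(mτ + nτ' + xv₁ + yv₂)`. -/
def fourierSeries (A : (ℤ × ℤ) × (ℤ × ℤ) → ℂ) (τ v₁ v₂ τ' : ℂ) : ℂ :=
  ∑' i : (ℤ × ℤ) × (ℤ × ℤ),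
    A i * expTwoPiI (i.1.1 * τ + i.1.2 * τ' + (i.2.1 * v₁ + i.2.2 * v₂))

/-- The moments of `A` in the off-diagonal variables: the Taylor coefficients of the Fourier series
along `v₁ = v₂ = 0`, up to normalisation. -/
def moment (A : (ℤ × ℤ) × (ℤ × ℤ) → ℂ) (j : ℕ) (v₁ v₂ : ℂ) (q : ℤ × ℤ) : ℂ :=
  ∑' p : ℤ × ℤ, A (q, p) * (p.1 * v₁ + p.2 * v₂) ^ j

/-- The properties of the Fourier coefficients of a Hermitian modular form over `ℚ(√-3)` of even
weight `k` that are used below, in the coordinates `m`, `n`, `x = tr α`, `y = tr (ωα)`. -/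
structure HermitianCoeffs (A : (ℤ × ℤ) × (ℤ × ℤ) → ℂ) (k : ℤ) : Prop where
  support : ∀ i, A i ≠ 0 → 0 ≤ i.1.1 ∧ 0 ≤ i.1.2 ∧
    |i.2.1| ≤ i.1.1 + i.1.2 ∧ |i.2.2| ≤ i.1.1 + i.1.2
  summable : ∀ ε : ℝ, 0 < ε → Summable fun i => ‖A i‖ * Real.exp (-ε * (i.1.1 + i.1.2))
  shift : ∀ p q : ℤ, p ^ 2 - p * q + q ^ 2 = 1 → ∀ m n x y : ℤ,
    A ((m, n + x * p + y * q + m), (x + m * (2 * p - q), y + m * (2 * q - p))) = A ((m, n), (x, y))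
  swap : ∀ m n x y : ℤ, A ((m, n), (x, y)) = A ((n, m), (x, -x - y))
  inversion : ∀ τ τ' v₁ v₂ : ℂ, 0 < τ.im → 0 < τ'.im → ∀ᶠ t : ℝ in nhds 0,
    fourierSeries A (-1 / τ) (t * (v₁ / τ)) (t * (v₂ / τ))
        (τ' + -(v₁ ^ 2 - v₁ * v₂ + v₂ ^ 2) / τ * t ^ 2)
      = τ ^ k * fourierSeries A τ (t * v₁) (t * v₂) τ'

lemma Summable.ite_zero {ι : Type*} {f : ι → ℂ} (hf : Summable f) (P : ι → Prop)
    [DecidablePred P] : Summable fun i => if P i then f i else 0 :=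
  Summable.of_norm_bounded hf.norm fun i => by
    split_ifs
    · exact le_rfl
    · exact norm_zero.trans_le (norm_nonneg _)

lemma im_neg_one_div_pos {τ : ℂ} (hτ : 0 < τ.im) : 0 < (-1 / τ).im := by
  have hτ0 : τ ≠ 0 := fun h => hτ.ne' (by rw [h, Complex.zero_im])
  rw [neg_div, one_div, Complex.neg_im, Complex.inv_im, neg_div, neg_neg]
  exact div_pos hτ (Complex.normSq_pos.mpr hτ0)

lemma tendsto_exp_sub_taylor_div_pow (z : ℂ) (j : ℕ) :
    Filter.Tendsto (fun t : ℝ => (Complex.exp (t * z)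
      - ∑ r ∈ Finset.range j, (t * z) ^ r / (r.factorial : ℂ)) / (t : ℂ) ^ j)
      (nhdsWithin 0 {0}ᶜ) (nhds (z ^ j / (j.factorial : ℂ))) := by
  rw [tendsto_iff_norm_sub_tendsto_zero]
  have hb : Filter.Tendsto (fun t : ℝ => |t| * ‖z‖ ^ (j + 1) * Real.exp (|t| * ‖z‖))
      (nhdsWithin 0 {0}ᶜ) (nhds 0) := by
    have : Continuous fun t : ℝ => |t| * ‖z‖ ^ (j + 1) * Real.exp (|t| * ‖z‖) := by fun_prop
    simpa using (this.tendsto 0).mono_left nhdsWithin_le_nhds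
  refine squeeze_zero' (Filter.Eventually.of_forall fun _ => norm_nonneg _) ?_ hb
  filter_upwards [self_mem_nhdsWithin] with t ht
  have ht : (t : ℂ) ≠ 0 := by simpa using ht
  have h1 := Complex.norm_exp_sub_sum_le_norm_mul_exp (t * z) (j + 1)
  have h2 : (Complex.exp (t * z) - ∑ r ∈ Finset.range j, (t * z) ^ r / (r.factorial : ℂ)) / t ^ j
      - z ^ j / (j.factorial : ℂ)
      = (Complex.exp (t * z) - ∑ r ∈ Finset.range (j + 1), (t * z) ^ r / (r.factorial : ℂ))
        / t ^ j := by
    rw [Finset.sum_range_succ, mul_pow]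
    field_simp
    ring
  rw [h2, norm_div, norm_pow, div_le_iff₀ (by positivity)]
  refine h1.trans_eq ?_
  rw [norm_mul, mul_pow, Complex.norm_real, Real.norm_eq_abs]
  ring

namespace HermitianCoeffs

variable {A : (ℤ × ℤ) × (ℤ × ℤ) → ℂ} {k : ℤ}

lemma summable_pow (hA : HermitianCoeffs A k) {ε : ℝ} (hε : 0 < ε) (j : ℕ) :
    Summable fun i => ‖A i‖ * ((i.1.1 + i.1.2 : ℝ) ^ j * Real.exp (-ε * (i.1.1 + i.1.2))) := by
  have hs := (hA.summable (ε / 2) (by positivity)).mul_left (j.factorial / (ε / 2) ^ j)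
  refine Summable.of_norm_bounded hs fun i => ?_
  by_cases hi : A i = 0
  · simp [hi]
  obtain ⟨h1, h2, -, -⟩ := hA.support i hi
  have hs0 : (0 : ℝ) ≤ i.1.1 + i.1.2 := by exact_mod_cast add_nonneg h1 h2
  set s : ℝ := i.1.1 + i.1.2
  have hpow := Real.pow_div_factorial_le_exp (ε / 2 * s) (by positivity) j
  rw [div_le_iff₀ (by positivity), mul_pow] at hpow
  have hexp : Real.exp (-ε * s) = Real.exp (-(ε / 2) * s) * (Real.exp (ε / 2 * s))⁻¹ := by
    rw [← Real.exp_neg, ← Real.exp_add]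
    congr 1
    ring
  rw [Real.norm_of_nonneg (by positivity), hexp]
  have h3 : s ^ j ≤ j.factorial / (ε / 2) ^ j * Real.exp (ε / 2 * s) := by
    rw [div_mul_eq_mul_div, le_div_iff₀ (by positivity)]
    linarith
  calc ‖A i‖ * (s ^ j * (Real.exp (-(ε / 2) * s) * (Real.exp (ε / 2 * s))⁻¹))
      ≤ ‖A i‖ * ((j.factorial / (ε / 2) ^ j * Real.exp (ε / 2 * s))
        * (Real.exp (-(ε / 2) * s) * (Real.exp (ε / 2 * s))⁻¹)) := by gcongr
    _ = _ := by field_simp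

lemma norm_linear_le (hA : HermitianCoeffs A k) (v₁ v₂ : ℂ) {i : (ℤ × ℤ) × (ℤ × ℤ)}
    (hi : A i ≠ 0) :
    ‖(i.2.1 : ℂ) * v₁ + i.2.2 * v₂‖ ≤ (‖v₁‖ + ‖v₂‖) * (i.1.1 + i.1.2) := by
  obtain ⟨-, -, h3, h4⟩ := hA.support i hi
  have h3' : |(i.2.1 : ℝ)| ≤ i.1.1 + i.1.2 := by exact_mod_cast h3
  have h4' : |(i.2.2 : ℝ)| ≤ i.1.1 + i.1.2 := by exact_mod_cast h4
  refine (norm_add_le _ _).trans ?_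
  rw [norm_mul, norm_mul, Complex.norm_intCast, Complex.norm_intCast]
  nlinarith [norm_nonneg v₁, norm_nonneg v₂]

lemma norm_expTwoPiI_le (hA : HermitianCoeffs A k) {τ τ' : ℂ} {ε : ℝ} (h : ε ≤ τ.im)
    (h' : ε ≤ τ'.im) {i : (ℤ × ℤ) × (ℤ × ℤ)} (hi : A i ≠ 0) :
    ‖expTwoPiI (i.1.1 * τ + i.1.2 * τ')‖ ≤ Real.exp (-(2 * Real.pi * ε) * (i.1.1 + i.1.2)) := by
  obtain ⟨h1, h2, -, -⟩ := hA.support i hi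
  have h1' : (0 : ℝ) ≤ i.1.1 := by exact_mod_cast h1
  have h2' : (0 : ℝ) ≤ i.1.2 := by exact_mod_cast h2
  rw [norm_expTwoPiI]
  have him : ((i.1.1 : ℂ) * τ + i.1.2 * τ').im = i.1.1 * τ.im + i.1.2 * τ'.im := by simp
  rw [him]
  have : ε * (i.1.1 + i.1.2 : ℝ) ≤ i.1.1 * τ.im + i.1.2 * τ'.im := by nlinarith
  refine Real.exp_le_exp.mpr ?_
  nlinarith [Real.pi_pos]

lemma summable_mul_pow (hA : HermitianCoeffs A k) (j : ℕ) (v₁ v₂ : ℂ) {τ τ' : ℂ}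
    (hτ : 0 < τ.im) (hτ' : 0 < τ'.im) :
    Summable fun i => A i * (i.2.1 * v₁ + i.2.2 * v₂) ^ j
      * expTwoPiI (i.1.1 * τ + i.1.2 * τ') := by
  set ε := min τ.im τ'.im
  have hε0 : 0 < ε := lt_min hτ hτ'
  refine Summable.of_norm_bounded ((hA.summable_pow (ε := 2 * Real.pi * ε) (by positivity)
    j).mul_left ((‖v₁‖ + ‖v₂‖) ^ j)) fun i => ?_
  by_cases hi : A i = 0
  · simp [hi]
  rw [norm_mul, norm_mul, norm_pow]
  calc _ ≤ ‖A i‖ * ((‖v₁‖ + ‖v₂‖) * (i.1.1 + i.1.2)) ^ j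
        * Real.exp (-(2 * Real.pi * ε) * (i.1.1 + i.1.2)) := by
        have h0 := (norm_nonneg _).trans (hA.norm_linear_le v₁ v₂ hi)
        gcongr
        · exact hA.norm_linear_le v₁ v₂ hi
        · exact hA.norm_expTwoPiI_le (min_le_left _ _) (min_le_right _ _) hi
    _ = _ := by rw [mul_pow]; ring

lemma finite_support (hA : HermitianCoeffs A k) (q : ℤ × ℤ) :
    ∀ p ∉ Finset.Icc (-(q.1 + q.2)) (q.1 + q.2) ×ˢ Finset.Icc (-(q.1 + q.2)) (q.1 + q.2),
      A (q, p) = 0 := by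
  intro p hp
  by_contra hne
  obtain ⟨-, -, h3, h4⟩ := hA.support (q, p) hne
  apply hp
  rw [Finset.mem_product, Finset.mem_Icc, Finset.mem_Icc]
  exact ⟨abs_le.mp h3, abs_le.mp h4⟩

lemma hasSum_moment (hA : HermitianCoeffs A k) (j : ℕ) (v₁ v₂ : ℂ) (q : ℤ × ℤ) :
    HasSum (fun p : ℤ × ℤ => A (q, p) * (p.1 * v₁ + p.2 * v₂) ^ j) (moment A j v₁ v₂ q) := by
  refine (summable_of_ne_finset_zero (s := Finset.Icc (-(q.1 + q.2)) (q.1 + q.2) ×ˢ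
    Finset.Icc (-(q.1 + q.2)) (q.1 + q.2)) fun p hp => ?_).hasSum
  rw [hA.finite_support q p hp, zero_mul]

lemma hasSum_moment_mul (hA : HermitianCoeffs A k) (j : ℕ) (v₁ v₂ : ℂ) {τ τ' : ℂ}
    (hτ : 0 < τ.im) (hτ' : 0 < τ'.im) :
    HasSum (fun q : ℤ × ℤ => moment A j v₁ v₂ q * expTwoPiI (q.1 * τ + q.2 * τ'))
      (∑' i, A i * (i.2.1 * v₁ + i.2.2 * v₂) ^ j * expTwoPiI (i.1.1 * τ + i.1.2 * τ')) := by
  refine HasSum.prod_fiberwise (hA.summable_mul_pow j v₁ v₂ hτ hτ').hasSum fun q => ?_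
  exact (hA.hasSum_moment j v₁ v₂ q).mul_right (expTwoPiI (q.1 * τ + q.2 * τ'))

/-- If all moments of order less than `j` vanish, the leading term of the Fourier series along
`v₁ = v₂ = 0` is given by the moments of order `j`. -/
lemma tendsto_fourierSeries_div_pow (hA : HermitianCoeffs A k) {j : ℕ}
    (hj : ∀ r < j, ∀ v₁ v₂ q, moment A r v₁ v₂ q = 0) (v₁ v₂ c : ℂ) {τ τ' : ℂ}
    (hτ : 0 < τ.im) (hτ' : 0 < τ'.im) :
    Filter.Tendsto (fun t : ℝ => fourierSeries A τ (t * v₁) (t * v₂) (τ' + c * t ^ 2) / (t : ℂ) ^ j)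
      (nhdsWithin 0 {0}ᶜ) (nhds ((2 * Real.pi * Complex.I) ^ j / (j.factorial : ℂ) *
        ∑' i, A i * (i.2.1 * v₁ + i.2.2 * v₂) ^ j * expTwoPiI (i.1.1 * τ + i.1.2 * τ'))) := by
  set z : (ℤ × ℤ) × (ℤ × ℤ) → ℂ := fun i => i.2.1 * v₁ + i.2.2 * v₂ with hz
  set κ : ℂ := 2 * Real.pi * Complex.I with hκ
  set ε := min (τ.im / 2) (τ'.im / 2)
  have hε : 0 < ε := lt_min (by positivity) (by positivity)
  set V : ℝ := ‖v₁‖ + ‖v₂‖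
  have hV : 0 ≤ V := by positivity
  have hκn : ‖κ‖ = 2 * Real.pi := by
    simp [hκ, abs_of_pos Real.pi_pos]
  have hlim_im : ∀ᶠ t : ℝ in nhdsWithin 0 {0}ᶜ, ε < (τ' + c * t ^ 2).im := by
    have hcont : Continuous fun t : ℝ => (τ' + c * t ^ 2 : ℂ).im := by fun_prop
    refine ((hcont.tendsto 0).mono_left nhdsWithin_le_nhds).eventually_const_lt ?_
    have : ε ≤ τ'.im / 2 := min_le_right _ _
    simp
    linarith
  have hlim_t : ∀ᶠ t : ℝ in nhdsWithin 0 {0}ᶜ, |t| * V < ε / 2 := by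
    have hcont : Continuous fun t : ℝ => |t| * V := by fun_prop
    refine ((hcont.tendsto 0).mono_left nhdsWithin_le_nhds).eventually_lt_const ?_
    simpa using hε
  have hτε : ε ≤ τ.im := (min_le_left _ _).trans (by linarith)
  let g : ℝ → (ℤ × ℤ) × (ℤ × ℤ) → ℂ := fun t i =>
    A i * expTwoPiI (i.1.1 * τ + i.1.2 * (τ' + c * t ^ 2)) * ((Complex.exp (t * (κ * z i))
      - ∑ r ∈ Finset.range j, (t * (κ * z i)) ^ r / (r.factorial : ℂ)) / (t : ℂ) ^ j)
  let bound : (ℤ × ℤ) × (ℤ × ℤ) → ℝ := fun i => (2 * Real.pi * V) ^ j *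
    (‖A i‖ * ((i.1.1 + i.1.2 : ℝ) ^ j * Real.exp (-(Real.pi * ε) * (i.1.1 + i.1.2))))
  have hbound_summable : Summable bound := (hA.summable_pow (by positivity) j).mul_left _
  have hbound : ∀ᶠ t : ℝ in nhdsWithin 0 {0}ᶜ, ∀ i, ‖g t i‖ ≤ bound i := by
    filter_upwards [hlim_im, hlim_t, self_mem_nhdsWithin] with t ht1 ht2 ht0 i
    have ht0 : t ≠ 0 := by simpa using ht0
    by_cases hi : A i = 0
    · simp [g, bound, hi]
    have hzi := hA.norm_linear_le v₁ v₂ hi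
    have hs0 : (0 : ℝ) ≤ i.1.1 + i.1.2 := by
      obtain ⟨h1, h2, -, -⟩ := hA.support i hi
      exact_mod_cast add_nonneg h1 h2
    have h1 := hA.norm_expTwoPiI_le hτε ht1.le hi
    have h2 := Complex.norm_exp_sub_sum_le_norm_mul_exp (t * (κ * z i)) j
    set s : ℝ := i.1.1 + i.1.2
    have hnorm : ‖(t : ℂ) * (κ * z i)‖ = |t| * (2 * Real.pi * ‖z i‖) := by
      rw [norm_mul, norm_mul, hκn, Complex.norm_real, Real.norm_eq_abs]
    have h3 : ‖(Complex.exp (t * (κ * z i)) - ∑ r ∈ Finset.range j,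
        (t * (κ * z i)) ^ r / (r.factorial : ℂ)) / (t : ℂ) ^ j‖
        ≤ (2 * Real.pi * (V * s)) ^ j * Real.exp (Real.pi * ε * s) := by
      rw [norm_div, norm_pow, Complex.norm_real, Real.norm_eq_abs, div_le_iff₀ (by positivity)]
      refine h2.trans ?_
      rw [hnorm, mul_pow]
      have h4 : |t| * (2 * Real.pi * ‖z i‖) ≤ Real.pi * ε * s := by
        calc |t| * (2 * Real.pi * ‖z i‖) ≤ |t| * (2 * Real.pi * (V * s)) := by gcongr
          _ = 2 * Real.pi * s * (|t| * V) := by ring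
          _ ≤ 2 * Real.pi * s * (ε / 2) := by gcongr
          _ = _ := by ring
      calc |t| ^ j * (2 * Real.pi * ‖z i‖) ^ j * Real.exp (|t| * (2 * Real.pi * ‖z i‖))
          ≤ |t| ^ j * (2 * Real.pi * (V * s)) ^ j * Real.exp (Real.pi * ε * s) := by gcongr
        _ = _ := by ring
    have hexp : Real.exp (-(2 * Real.pi * ε) * s) * Real.exp (Real.pi * ε * s)
        = Real.exp (-(Real.pi * ε) * s) := by
      rw [← Real.exp_add]
      congr 1
      ring
    simp only [g]
    rw [norm_mul, norm_mul]
    calc _ ≤ ‖A i‖ * Real.exp (-(2 * Real.pi * ε) * s)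
          * ((2 * Real.pi * (V * s)) ^ j * Real.exp (Real.pi * ε * s)) := by gcongr
      _ = (2 * Real.pi * V) ^ j * (‖A i‖ * (s ^ j
          * (Real.exp (-(2 * Real.pi * ε) * s) * Real.exp (Real.pi * ε * s)))) := by
        simp only [mul_pow]
        ring
      _ = _ := by rw [hexp]
  have hg : ∀ᶠ t : ℝ in nhdsWithin 0 {0}ᶜ, ∑' i, g t i
      = fourierSeries A τ (t * v₁) (t * v₂) (τ' + c * t ^ 2) / (t : ℂ) ^ j := by
    filter_upwards [hlim_im, hbound] with t ht1 htb
    have hT : ∀ r ∈ Finset.range j, HasSum (fun i => (t * κ) ^ r / (r.factorial : ℂ) / (t : ℂ) ^ j *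
        (A i * z i ^ r * expTwoPiI (i.1.1 * τ + i.1.2 * (τ' + c * t ^ 2)))) 0 := by
      intro r hr
      have hs := hA.summable_mul_pow r v₁ v₂ hτ (hε.trans ht1)
      have hm := hA.hasSum_moment_mul r v₁ v₂ hτ (hε.trans ht1)
      simp only [hj r (Finset.mem_range.mp hr), zero_mul] at hm
      have h0 := hs.hasSum
      rw [hm.unique hasSum_zero] at h0
      simpa using h0.mul_left ((t * κ) ^ r / (r.factorial : ℂ) / (t : ℂ) ^ j)
    have hsum := (hbound_summable.of_norm_bounded htb).hasSum.add (hasSum_sum hT)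
    rw [Finset.sum_const_zero, add_zero] at hsum
    rw [← hsum.tsum_eq, fourierSeries, ← tsum_div_const]
    refine tsum_congr fun i => ?_
    rw [expTwoPiI_add _ (_ + _)]
    have h1 : expTwoPiI ((i.2.1 : ℂ) * (t * v₁) + i.2.2 * (t * v₂))
        = Complex.exp (t * (κ * z i)) := by
      rw [expTwoPiI, hz, hκ]
      congr 1
      ring
    have h2 : ∑ r ∈ Finset.range j, (t * κ) ^ r / (r.factorial : ℂ) / (t : ℂ) ^ j *
        (A i * z i ^ r * expTwoPiI (i.1.1 * τ + i.1.2 * (τ' + c * t ^ 2)))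
        = A i * expTwoPiI (i.1.1 * τ + i.1.2 * (τ' + c * t ^ 2))
          * ((∑ r ∈ Finset.range j, (t * (κ * z i)) ^ r / (r.factorial : ℂ)) / (t : ℂ) ^ j) := by
      rw [Finset.sum_div, Finset.mul_sum]
      refine Finset.sum_congr rfl fun r _ => ?_
      simp only [mul_pow]
      ring
    rw [h1, h2]
    simp only [g]
    ring
  have hmain : Filter.Tendsto (fun t => ∑' i, g t i) (nhdsWithin 0 {0}ᶜ)
      (nhds (∑' i, A i * expTwoPiI (i.1.1 * τ + i.1.2 * τ')
        * ((κ * z i) ^ j / (j.factorial : ℂ)))) := by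
    refine tendsto_tsum_of_dominated_convergence hbound_summable (fun i => ?_) hbound
    refine Filter.Tendsto.mul ?_ (tendsto_exp_sub_taylor_div_pow (κ * z i) j)
    have hcont : Continuous fun t : ℝ =>
        A i * expTwoPiI (i.1.1 * τ + i.1.2 * (τ' + c * t ^ 2)) := by
      have := continuous_expTwoPiI
      fun_prop
    simpa using (hcont.tendsto 0).mono_left nhdsWithin_le_nhds
  refine (hmain.congr' hg).trans_eq ?_
  rw [← tsum_mul_left]
  congr 1
  refine tsum_congr fun i => ?_
  simp only [hz, mul_pow]
  ring

/-- The leading Taylor coefficient along `v₁ = v₂ = 0` transforms with weight `k + j`. -/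
lemma tsum_mul_pow_inversion (hA : HermitianCoeffs A k) {j : ℕ}
    (hj : ∀ r < j, ∀ v₁ v₂ q, moment A r v₁ v₂ q = 0) (v₁ v₂ : ℂ) {τ τ' : ℂ}
    (hτ : 0 < τ.im) (hτ' : 0 < τ'.im) :
    ∑' i, A i * (i.2.1 * v₁ + i.2.2 * v₂) ^ j * expTwoPiI (i.1.1 * (-1 / τ) + i.1.2 * τ')
      = τ ^ (k + j) *
        ∑' i, A i * (i.2.1 * v₁ + i.2.2 * v₂) ^ j * expTwoPiI (i.1.1 * τ + i.1.2 * τ') := by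
  have hτ0 : τ ≠ 0 := by
    rintro rfl
    simp at hτ
  have hSτ := im_neg_one_div_pos hτ
  have h1 := hA.tendsto_fourierSeries_div_pow hj (v₁ / τ) (v₂ / τ)
    (-(v₁ ^ 2 - v₁ * v₂ + v₂ ^ 2) / τ) hSτ hτ'
  have h2 := (hA.tendsto_fourierSeries_div_pow hj v₁ v₂ 0 hτ hτ').const_mul (τ ^ k)
  have h3 := tendsto_nhds_unique (h1.congr' (f₂ := fun t : ℝ => τ ^ k *
    (fourierSeries A τ (t * v₁) (t * v₂) (τ' + 0 * t ^ 2) / (t : ℂ) ^ j)) ?_) h2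
  · have hC : (2 * Real.pi * Complex.I : ℂ) ^ j / (j.factorial : ℂ) ≠ 0 :=
      div_ne_zero (pow_ne_zero _ (by simp [Real.pi_ne_zero]))
        (by exact_mod_cast j.factorial_ne_zero)
    rw [mul_left_comm] at h3
    have h4 := mul_left_cancel₀ hC h3
    rw [zpow_add₀ hτ0, zpow_natCast, mul_right_comm, ← h4, mul_comm, ← tsum_mul_left]
    refine tsum_congr fun i => ?_
    rw [show (i.2.1 : ℂ) * (v₁ / τ) + i.2.2 * (v₂ / τ) = (i.2.1 * v₁ + i.2.2 * v₂) / τ by ring,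
      div_pow]
    field_simp
  · filter_upwards [(hA.inversion τ τ' v₁ v₂ hτ hτ').filter_mono nhdsWithin_le_nhds] with t ht
    rw [ht, zero_mul, add_zero, mul_div_assoc]

lemma moment_eq_zero_of_neg (hA : HermitianCoeffs A k) (j : ℕ) (v₁ v₂ : ℂ) {q : ℤ × ℤ}
    (hq : q.1 < 0) : moment A j v₁ v₂ q = 0 := by
  have h : ∀ p, A (q, p) = 0 := fun p => by
    by_contra hne
    have := (hA.support (q, p) hne).1
    simp only at this
    omega
  simp [moment, h]

lemma hasSum_moment_fiber (hA : HermitianCoeffs A k) (j : ℕ) (v₁ v₂ : ℂ) (n : ℤ) {τ : ℂ}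
    (hτ : 0 < τ.im) :
    HasSum (fun m : ℕ => moment A j v₁ v₂ (m, n) * expTwoPiI (m * τ))
      (expTwoPiI (-(n * Complex.I)) * ∑' i, if i.1.2 = n then A i * (i.2.1 * v₁ + i.2.2 * v₂) ^ j
        * expTwoPiI (i.1.1 * τ + i.1.2 * Complex.I) else 0) := by
  have hs := hA.summable_mul_pow j v₁ v₂ hτ (τ' := Complex.I) (by simp)
  have hs' := hs.ite_zero fun i => i.1.2 = n
  have h1 : HasSum (fun q : ℤ × ℤ => if q.2 = n then
      moment A j v₁ v₂ q * expTwoPiI (q.1 * τ + q.2 * Complex.I) else 0)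
      (∑' i, if i.1.2 = n then A i * (i.2.1 * v₁ + i.2.2 * v₂) ^ j
        * expTwoPiI (i.1.1 * τ + i.1.2 * Complex.I) else 0) := by
    refine HasSum.prod_fiberwise hs'.hasSum fun q => ?_
    by_cases hq : q.2 = n
    · simp only [hq, if_true]
      exact (hA.hasSum_moment j v₁ v₂ q).mul_right (expTwoPiI (q.1 * τ + n * Complex.I))
    · simp only [hq, if_false]
      exact hasSum_zero
  have hinj : Function.Injective fun m : ℕ => ((m : ℤ), n) := fun a b hab => by
    simpa using hab
  rw [← hinj.hasSum_iff] at h1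
  · refine HasSum.congr_fun (h1.mul_left (expTwoPiI (-(n * Complex.I)))) fun m => ?_
    simp only [Function.comp_apply, if_true, Int.cast_natCast]
    rw [mul_left_comm, ← expTwoPiI_add]
    congr 2
    ring
  · rintro ⟨m, n'⟩ hq
    split_ifs with hn
    · rw [hA.moment_eq_zero_of_neg, zero_mul]
      by_contra hm
      exact hq ⟨m.toNat, by simp_all⟩
    · rfl

/-- The Sturm bound for the lowest non-vanishing moments. -/
lemma exists_moment_ne_zero (hA : HermitianCoeffs A k) {j : ℕ}
    (hj : ∀ r < j, ∀ v₁ v₂ q, moment A r v₁ v₂ q = 0) {v₁ v₂ : ℂ} {m n : ℤ}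
    (hne : moment A j v₁ v₂ (m, n) ≠ 0) :
    ∃ m' : ℕ, 12 * (m' : ℤ) ≤ k + j ∧ moment A j v₁ v₂ (m', n) ≠ 0 := by
  by_contra! hcon
  have hc := coeff_eq_zero_of_transform_of_sturm (c := fun m : ℕ => moment A j v₁ v₂ (m, n))
    (w := k + j) (fun τ hτ => (hA.hasSum_moment_fiber j v₁ v₂ n hτ).summable) (fun τ hτ => ?_) hcon
  · rcases lt_or_ge m 0 with hm | hm
    · exact hne (hA.moment_eq_zero_of_neg j v₁ v₂ hm)
    · lift m to ℕ using hm
      exact hne (congr_fun hc m)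
  have hSτ := im_neg_one_div_pos hτ
  rw [(hA.hasSum_moment_fiber j v₁ v₂ n hSτ).tsum_eq, (hA.hasSum_moment_fiber j v₁ v₂ n hτ).tsum_eq,
    mul_left_comm]
  congr 1
  have hI : 0 < Complex.I.im := by simp
  let a : ℂ → (ℤ × ℤ) × (ℤ × ℤ) → ℂ := fun σ i =>
    A i * (i.2.1 * v₁ + i.2.2 * v₂) ^ j * expTwoPiI (i.1.1 * σ + i.1.2 * Complex.I)
  have ha : ∀ {σ : ℂ}, 0 < σ.im → Summable (a σ) := fun hσ => hA.summable_mul_pow j v₁ v₂ hσ hI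
  have hfib := tsum_fiber_eq_zero ((ha hSτ).sub ((ha hτ).mul_left (τ ^ (k + j))))
    (fun i => i.1.2) (fun t => ?_) n
  · change ∑' i, (if i.1.2 = n then a (-1 / τ) i else 0)
      = τ ^ (k + j) * ∑' i, (if i.1.2 = n then a τ i else 0)
    have hfs := fun {σ : ℂ} (hσ : 0 < σ.im) => (ha hσ).ite_zero fun i => i.1.2 = n
    rw [← sub_eq_zero, ← tsum_mul_left, ← (hfs hSτ).tsum_sub ((hfs hτ).mul_left (τ ^ (k + j)))]
    refine Eq.trans (tsum_congr fun i => ?_) hfib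
    split_ifs <;> simp
  · have hIt : 0 < (Complex.I + t).im := by simp
    have hat : ∀ (σ : ℂ) i, a σ i * expTwoPiI (i.1.2 * t) =
        A i * (i.2.1 * v₁ + i.2.2 * v₂) ^ j * expTwoPiI (i.1.1 * σ + i.1.2 * (Complex.I + t)) := by
      intro σ i
      simp only [a]
      rw [mul_assoc, ← expTwoPiI_add]
      congr 2
      ring
    have h := hA.tsum_mul_pow_inversion hj v₁ v₂ hτ hIt
    rw [← sub_eq_zero, ← tsum_mul_left, ← Summable.tsum_sub] at h
    · rw [← h]
      refine tsum_congr fun i => ?_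
      rw [sub_mul, mul_assoc (τ ^ (k + j)), hat, hat]
    · exact hA.summable_mul_pow j v₁ v₂ hSτ hIt
    · exact (hA.summable_mul_pow j v₁ v₂ hτ hIt).mul_left _

lemma moment_swap (hA : HermitianCoeffs A k) (j : ℕ) (v₁ v₂ : ℂ) (m n : ℤ) :
    moment A j v₁ v₂ (m, n) = moment A j (v₁ - v₂) (-v₂) (n, m) := by
  let e : ℤ × ℤ ≃ ℤ × ℤ :=
    Function.Involutive.toPerm (fun p => (p.1, -p.1 - p.2)) fun p => by ext <;> simp
  rw [moment, moment, ← e.tsum_eq]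
  refine tsum_congr fun p => ?_
  change A ((m, n), (p.1, -p.1 - p.2)) * ((p.1 : ℂ) * v₁ + ((-p.1 - p.2 : ℤ) : ℂ) * v₂) ^ j = _
  rw [hA.swap m n, show -p.1 - (-p.1 - p.2) = p.2 by ring]
  push_cast
  congr 2
  ring

/-- A non-zero Fourier–Jacobi coefficient of index `m` has a non-vanishing moment of order at most
`3m`. -/
lemma exists_moment_ne_zero_of_coeff_ne_zero (hA : HermitianCoeffs A k) {m : ℕ} {n : ℤ}
    {p : ℤ × ℤ} (hne : A ((m, n), p) ≠ 0) :
    ∃ j ≤ 3 * m, ∃ v₁ v₂ n', moment A j v₁ v₂ (m, n') ≠ 0 := by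
  classical
  have hex : ∃ n : ℕ, ∃ p, A (((m : ℤ), (n : ℤ)), p) ≠ 0 := by
    have hn := (hA.support _ hne).2.1
    lift n to ℕ using hn
    exact ⟨n, p, hne⟩
  obtain ⟨n₀, ⟨p₀, hp₀⟩, hmin⟩ : ∃ n₀ : ℕ, (∃ p, A (((m : ℤ), (n₀ : ℤ)), p) ≠ 0) ∧
      ∀ (n' : ℤ) p, A (((m : ℤ), n'), p) ≠ 0 → (n₀ : ℤ) ≤ n' := by
    refine ⟨Nat.find hex, Nat.find_spec hex, fun n' p hp => ?_⟩
    have hn := (hA.support _ hp).2.1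
    lift n' to ℕ using hn
    exact_mod_cast Nat.find_min' hex ⟨p, hp⟩
  by_contra! hcon
  refine hp₀ (congr_fun (eq_zero_of_moments_hexagon (B := fun p => A (((m : ℤ), (n₀ : ℤ)), p)) m
    (T := Finset.Icc (-((m : ℤ) + n₀)) (m + n₀) ×ˢ Finset.Icc (-((m : ℤ) + n₀)) (m + n₀))
    (fun p hp => ⟨?_, ?_⟩) fun j hj v₁ v₂ => ?_) p₀)
  · by_contra hT
    exact hp (hA.finite_support ((m : ℤ), (n₀ : ℤ)) p hT)
  · have key : ∀ a b : ℤ, a ^ 2 - a * b + b ^ 2 = 1 → 0 ≤ p.1 * a + p.2 * b + m := by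
      intro a b hab
      have h := hA.shift a b hab m n₀ p.1 p.2
      have := hmin _ _ (h ▸ hp)
      linarith
    have h1 := key 1 0 (by norm_num)
    have h2 := key (-1) 0 (by norm_num)
    have h3 := key 0 1 (by norm_num)
    have h4 := key 0 (-1) (by norm_num)
    have h5 := key 1 1 (by norm_num)
    have h6 := key (-1) (-1) (by norm_num)
    simp only [abs_le]
    omega
  · rw [← hcon j hj v₁ v₂ n₀]
    refine (HasSum.unique (hA.hasSum_moment j v₁ v₂ _) (hasSum_sum_of_ne_finset_zero ?_)).symm
    intro p hp
    rw [hA.finite_support ((m : ℤ), (n₀ : ℤ)) p hp, zero_mul]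

/-- The coefficients vanish as soon as those with `m ≤ k / 9` and `n ≤ k / 9` do. -/
theorem eq_zero_of_forall_le (hA : HermitianCoeffs A k)
    (hvan : ∀ (m n : ℤ) p, 9 * m ≤ k → 9 * n ≤ k → A ((m, n), p) = 0) : A = 0 := by
  classical
  by_contra hne
  obtain ⟨⟨⟨m, n⟩, p⟩, hi⟩ := Function.ne_iff.mp hne
  have hcoeff : ∀ {j v₁ v₂ q}, moment A j v₁ v₂ q ≠ 0 → ∃ p, A (q, p) ≠ 0 := by
    intro j v₁ v₂ q hq
    by_contra! h
    exact hq (by simp [moment, h])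
  have hex : ∃ j v₁ v₂ q, moment A j v₁ v₂ q ≠ 0 := by
    have hm := (hA.support _ hi).1
    lift m to ℕ using hm
    obtain ⟨j, -, v₁, v₂, n', h⟩ := hA.exists_moment_ne_zero_of_coeff_ne_zero hi
    exact ⟨j, v₁, v₂, _, h⟩
  obtain ⟨v₁, v₂, ⟨m₀, n₀⟩, h₀⟩ := Nat.find_spec hex
  have hmin : ∀ r < Nat.find hex, ∀ v₁ v₂ q, moment A r v₁ v₂ q = 0 := by
    intro r hr v₁ v₂ q
    by_contra h
    exact Nat.find_min hex hr ⟨v₁, v₂, q, h⟩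
  set j := Nat.find hex
  obtain ⟨m₁, hm₁, h₁⟩ := hA.exists_moment_ne_zero hmin h₀
  rw [hA.moment_swap] at h₁
  obtain ⟨n₁, hn₁, h₂⟩ := hA.exists_moment_ne_zero hmin h₁
  rw [hA.moment_swap] at h₂
  obtain ⟨p₁, hp₁⟩ := hcoeff h₂
  obtain ⟨r, hr, w₁, w₂, n', hr'⟩ := hA.exists_moment_ne_zero_of_coeff_ne_zero hp₁
  have hjr : j ≤ r := by
    by_contra! h
    exact hr' (hmin r h _ _ _)
  exact hp₁ (hvan _ _ _ (by omega) (by omega))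

end HermitianCoeffs

lemma sqrtD_neg_three_sq : sqrtD (-3) ^ 2 = -3 := by
  rw [sqrtD, mul_pow, Complex.I_sq, ← Complex.ofReal_pow, Real.sq_sqrt (by norm_num)]
  norm_num

lemma conj_sqrtD (d : ℤ) : (starRingEnd ℂ) (sqrtD d) = -sqrtD d := by
  simp [sqrtD]

lemma sqrtD_neg_three_ne_zero : sqrtD (-3) ≠ 0 := by
  intro h
  have := sqrtD_neg_three_sq
  rw [h] at this
  norm_num at this

/-- The element of the inverse different of `ℚ(√-3)` with `tr α = x` and `tr (ωα) = y`. -/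
def offDiag (p : ℤ × ℤ) : ℂ := p.1 / 2 - sqrtD (-3) * (p.1 + 2 * p.2) / 6

lemma sqrtD_mul_offDiag (p : ℤ × ℤ) : sqrtD (-3) * offDiag p
    = ((p.2 + 2 * p.1 : ℤ) : ℂ) + (p.1 : ℂ) * ((((-3 : ℤ) : ℂ) + sqrtD (-3)) / 2) := by
  rw [offDiag]
  push_cast
  linear_combination (-(p.1 + 2 * p.2) / 6 : ℂ) * sqrtD_neg_three_sq

lemma offDiag_mem_invDiff (p : ℤ × ℤ) : offDiag p ∈ invDiff (-3) :=
  ⟨_, _, sqrtD_mul_offDiag p⟩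

lemma exists_offDiag_eq {α : ℂ} (hα : sqrtD (-3) * α ∈ ringInt (-3)) : ∃ p, offDiag p = α := by
  obtain ⟨a, b, hab⟩ := hα
  refine ⟨(b, a - 2 * b), mul_left_cancel₀ sqrtD_neg_three_ne_zero ?_⟩
  rw [hab, sqrtD_mul_offDiag]
  simp

lemma conj_offDiag (p : ℤ × ℤ) :
    (starRingEnd ℂ) (offDiag p) = p.1 / 2 + sqrtD (-3) * (p.1 + 2 * p.2) / 6 := by
  simp only [offDiag, map_sub, map_div₀, map_mul, map_add, map_intCast, map_ofNat, conj_sqrtD]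
  ring

lemma offDiag_mul_conj (p : ℤ × ℤ) : offDiag p * (starRingEnd ℂ) (offDiag p)
    = (p.1 ^ 2 + p.1 * p.2 + p.2 ^ 2) / 3 := by
  rw [conj_offDiag, offDiag]
  linear_combination (-(p.1 + 2 * p.2) ^ 2 / 36 : ℂ) * sqrtD_neg_three_sq

lemma offDiag_injective : Function.Injective offDiag := by
  intro p q h
  have h' := congrArg (starRingEnd ℂ) h
  rw [conj_offDiag, conj_offDiag] at h'
  simp only [offDiag] at h
  have h1 : (p.1 : ℂ) = q.1 := by linear_combination h + h'
  have h2 : (p.2 : ℂ) = q.2 := by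
    have := mul_left_cancel₀ sqrtD_neg_three_ne_zero
      (show sqrtD (-3) * (p.1 + 2 * p.2) = sqrtD (-3) * (q.1 + 2 * q.2) by
        linear_combination 3 * h' - 3 * h)
    linear_combination (this - h1) / 2
  exact Prod.ext (by exact_mod_cast h1) (by exact_mod_cast h2)

/-- The Hermitian matrix with coordinates `((m, n), (x, y))`. -/
def hermMatrix (i : (ℤ × ℤ) × (ℤ × ℤ)) : Matrix (Fin 2) (Fin 2) ℂ :=
  !![(i.1.1 : ℂ), offDiag i.2; (starRingEnd ℂ) (offDiag i.2), (i.1.2 : ℂ)]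

lemma hermMatrix_injective : Function.Injective hermMatrix := by
  intro i j h
  have h00 := congrFun₂ h 0 0
  have h01 := congrFun₂ h 0 1
  have h11 := congrFun₂ h 1 1
  simp only [hermMatrix, Matrix.of_apply, Matrix.cons_val', Matrix.cons_val_zero,
    Matrix.cons_val_one, Int.cast_inj] at h00 h01 h11
  exact Prod.ext (Prod.ext h00 h11) (offDiag_injective h01)

lemma exists_hermMatrix_eq {H : Matrix (Fin 2) (Fin 2) ℂ} (hH : H ∈ LambdaH (-3)) :
    ∃ i, hermMatrix i = H := by
  obtain ⟨hherm, hdiag, hoff⟩ := hH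
  obtain ⟨m, hm⟩ := hdiag 0
  obtain ⟨n, hn⟩ := hdiag 1
  obtain ⟨p, hp⟩ := exists_offDiag_eq (hoff 0 1)
  refine ⟨((m, n), p), ?_⟩
  ext i j
  fin_cases i <;> fin_cases j <;> simp [hermMatrix, hm, hn, hp]
  exact hherm.apply 1 0

lemma hermMatrix_posSemidef_bound {m n x y : ℤ} (h : (hermMatrix ((m, n), (x, y))).PosSemidef) :
    0 ≤ m ∧ 0 ≤ n ∧ x ^ 2 + x * y + y ^ 2 ≤ 3 * (m * n) := by
  have h0 := h.diag_nonneg (i := 0)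
  have h1 := h.diag_nonneg (i := 1)
  have hdet := h.det_nonneg
  rw [Matrix.det_fin_two] at hdet
  simp only [hermMatrix, Matrix.of_apply, Matrix.cons_val', Matrix.cons_val_zero,
    Matrix.cons_val_one, offDiag_mul_conj] at h0 h1 hdet
  refine ⟨by exact_mod_cast h0, by exact_mod_cast h1, ?_⟩
  have : (0 : ℂ) ≤ ((m * n - (x ^ 2 + x * y + y ^ 2) / 3 : ℝ) : ℂ) := by
    push_cast
    exact hdet
  rw [Complex.zero_le_real] at this
  have h3 : (x ^ 2 + x * y + y ^ 2 : ℝ) ≤ 3 * (m * n) := by linarith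
  exact_mod_cast h3

/-- The point of the Hermitian half-space with coordinates `τ, v₁, v₂, τ'`, in which the trace
pairing with `hermMatrix` is `mτ + nτ' + xv₁ + yv₂`. -/
def pointMatrix (τ v₁ v₂ τ' : ℂ) : Matrix (Fin 2) (Fin 2) ℂ :=
  !![τ, v₁ + v₂ * ((-1 - sqrtD (-3)) / 2); v₁ + v₂ * ((-1 + sqrtD (-3)) / 2), τ']

lemma trace_hermMatrix_mul_pointMatrix (i : (ℤ × ℤ) × (ℤ × ℤ)) (τ v₁ v₂ τ' : ℂ) :
    (hermMatrix i * pointMatrix τ v₁ v₂ τ').trace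
      = i.1.1 * τ + i.1.2 * τ' + (i.2.1 * v₁ + i.2.2 * v₂) := by
  simp only [hermMatrix, pointMatrix, Matrix.trace_fin_two, Matrix.mul_apply, Fin.sum_univ_two,
    Matrix.of_apply, Matrix.cons_val', Matrix.cons_val_zero, Matrix.cons_val_one, conj_offDiag]
  rw [offDiag]
  linear_combination (-(i.2.1 + 2 * i.2.2) * v₂ / 6 : ℂ) * sqrtD_neg_three_sq

lemma mem_hermitianUpperHalfSpace {Z : Matrix (Fin 2) (Fin 2) ℂ} (h0 : 0 < (Z 0 0).im)
    (h1 : Complex.normSq (Z 0 1 - (starRingEnd ℂ) (Z 1 0)) < 4 * ((Z 0 0).im * (Z 1 1).im)) :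
    Z ∈ HermitianUpperHalfSpace := by
  set b : ℂ := (Z 0 1 - (starRingEnd ℂ) (Z 1 0)) / (2 * Complex.I) with hb
  have hconj : (Z 1 0 - (starRingEnd ℂ) (Z 0 1)) / (2 * Complex.I) = (starRingEnd ℂ) b := by
    simp only [hb, map_div₀, map_sub, map_mul, map_ofNat, Complex.conj_I, Complex.conj_conj]
    rw [mul_neg, div_neg, ← neg_div, neg_sub]
  have hself : ∀ z : ℂ, (z - (starRingEnd ℂ) z) / (2 * Complex.I) = (z.im : ℂ) := by
    intro z
    rw [Complex.sub_conj]
    field_simp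
    push_cast
    ring
  have hM : (Z - Zᴴ).map (fun w => w / (2 * Complex.I))
      = !![((Z 0 0).im : ℂ), b; (starRingEnd ℂ) b, ((Z 1 1).im : ℂ)] := by
    ext i j
    fin_cases i <;> fin_cases j
    · simp [← hself]
    · simp [hb]
    · simpa using hconj
    · simp [← hself]
  have hbn : Complex.normSq b = Complex.normSq (Z 0 1 - (starRingEnd ℂ) (Z 1 0)) / 4 := by
    rw [hb, Complex.normSq_div]
    norm_num [Complex.normSq_apply]
  change ((Z - Zᴴ).map (fun w => w / (2 * Complex.I))).PosDef
  rw [hM]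
  set a := (Z 0 0).im
  set d := (Z 1 1).im
  have hD : 0 < a * d - Complex.normSq b := by
    rw [hbn]
    linarith
  refine Matrix.PosDef.of_dotProduct_mulVec_pos ?_ fun x hx => ?_
  · ext i j
    fin_cases i <;> fin_cases j <;> simp
  have hq : star x ⬝ᵥ (!![(a : ℂ), b; (starRingEnd ℂ) b, (d : ℂ)] *ᵥ x)
      = (((Complex.normSq (a * x 0 + b * x 1)
        + (a * d - Complex.normSq b) * Complex.normSq (x 1)) / a : ℝ) : ℂ) := by
    have ha : (a : ℂ) ≠ 0 := by exact_mod_cast h0.ne'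
    push_cast
    rw [eq_div_iff ha]
    simp only [← Complex.mul_conj, dotProduct, Matrix.mulVec, Fin.sum_univ_two, Pi.star_apply,
      Matrix.of_apply, Matrix.cons_val', Matrix.cons_val_zero, Matrix.cons_val_one, map_add,
      map_mul, Complex.conj_ofReal, RCLike.star_def]
    ring
  rw [hq, Complex.zero_lt_real]
  refine div_pos ?_ h0
  by_cases hx1 : x 1 = 0
  · have hx0 : x 0 ≠ 0 := by
      intro hx0
      apply hx
      ext i
      fin_cases i <;> simp [hx0, hx1]
    have : 0 < Complex.normSq (a * x 0) :=
      Complex.normSq_pos.mpr (mul_ne_zero (by exact_mod_cast h0.ne') hx0)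
    simpa [hx1] using this
  · have := mul_pos hD (Complex.normSq_pos.mpr hx1)
    linarith [Complex.normSq_nonneg (a * x 0 + b * x 1)]

lemma pointMatrix_mem {τ v₁ v₂ τ' : ℂ} (hτ : 0 < τ.im)
    (h : Complex.normSq (v₁ - (starRingEnd ℂ) v₁
      + (v₂ - (starRingEnd ℂ) v₂) * ((-1 - sqrtD (-3)) / 2)) < 4 * (τ.im * τ'.im)) :
    pointMatrix τ v₁ v₂ τ' ∈ HermitianUpperHalfSpace := by
  refine mem_hermitianUpperHalfSpace hτ ?_
  convert h using 2
  · simp only [pointMatrix, Matrix.of_apply, Matrix.cons_val', Matrix.cons_val_zero,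
      Matrix.cons_val_one, map_add, map_mul, map_div₀, map_neg, map_one, map_ofNat, conj_sqrtD]
    ring
  · rfl

lemma pointMatrix_ofReal_mem {τ τ' : ℂ} (hτ : 0 < τ.im) (hτ' : 0 < τ'.im) (v₁ v₂ : ℝ) :
    pointMatrix τ v₁ v₂ τ' ∈ HermitianUpperHalfSpace :=
  pointMatrix_mem hτ (by simpa using mul_pos hτ hτ')

lemma eventually_pointMatrix_mem {τ τ' : ℂ} (hτ : 0 < τ.im) (hτ' : 0 < τ'.im) (v₁ v₂ c : ℂ) :
    ∀ᶠ t : ℝ in nhds 0,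
      pointMatrix τ (t * v₁) (t * v₂) (τ' + c * t ^ 2) ∈ HermitianUpperHalfSpace := by
  have h1 : Continuous fun t : ℝ => Complex.normSq (t * v₁ - (starRingEnd ℂ) (t * v₁)
      + (t * v₂ - (starRingEnd ℂ) (t * v₂)) * ((-1 - sqrtD (-3)) / 2)) := by
    have := Complex.continuous_normSq
    have := Complex.continuous_conj
    fun_prop
  have h2 : Continuous fun t : ℝ => 4 * (τ.im * (τ' + c * t ^ 2 : ℂ).im) := by fun_prop
  filter_upwards [(h1.tendsto 0).eventually_lt (h2.tendsto 0) (by simpa using mul_pos hτ hτ')]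
    with t ht using pointMatrix_mem hτ ht

/-- Uniqueness of the coefficients of an absolutely convergent fourfold Fourier series. -/
lemma eq_zero_of_tsum_mul_expTwoPiI {g : (ℤ × ℤ) × (ℤ × ℤ) → ℂ} (hg : Summable g)
    (h : ∀ a b c d : ℝ, ∑' i : (ℤ × ℤ) × (ℤ × ℤ),
      g i * expTwoPiI (i.1.1 * a + i.1.2 * b + (i.2.1 * c + i.2.2 * d)) = 0) : g = 0 := by
  have hmul : ∀ (f : (ℤ × ℤ) × (ℤ × ℤ) → ℂ), Summable f → ∀ φ : (ℤ × ℤ) × (ℤ × ℤ) → ℝ,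
      Summable fun i => f i * expTwoPiI (φ i) := by
    intro f hf φ
    refine Summable.of_norm_bounded hf.norm fun i => ?_
    rw [norm_mul, norm_expTwoPiI, Complex.ofReal_im, mul_zero, Real.exp_zero, mul_one]
  funext ⟨⟨m, n⟩, ⟨x, y⟩⟩
  have h1 := hg.ite_zero fun i => i.1.1 = m
  have h2 := h1.ite_zero fun i => i.1.2 = n
  have h3 := h2.ite_zero fun i => i.2.1 = x
  have e1 : ∀ b c d : ℝ, ∑' i : (ℤ × ℤ) × (ℤ × ℤ), (if i.1.1 = m then g i else 0)
      * expTwoPiI ((i.1.2 * b + (i.2.1 * c + i.2.2 * d) : ℝ)) = 0 := by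
    intro b c d
    refine Eq.trans (tsum_congr fun i => ?_) (tsum_fiber_eq_zero
      (hmul g hg fun i => i.1.2 * b + (i.2.1 * c + i.2.2 * d)) (fun i => i.1.1)
      (fun a => Eq.trans (tsum_congr fun i => ?_) (h a b c d)) m)
    · rw [ite_mul, zero_mul]
    · rw [mul_assoc, ← expTwoPiI_add]
      congr 2
      push_cast
      ring
  have e2 : ∀ c d : ℝ, ∑' i : (ℤ × ℤ) × (ℤ × ℤ), (if i.1.2 = n then
      if i.1.1 = m then g i else 0 else 0) * expTwoPiI ((i.2.1 * c + i.2.2 * d : ℝ)) = 0 := by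
    intro c d
    refine Eq.trans (tsum_congr fun i => ?_) (tsum_fiber_eq_zero
      (hmul _ h1 fun i => i.2.1 * c + i.2.2 * d) (fun i => i.1.2)
      (fun b => Eq.trans (tsum_congr fun i => ?_) (e1 b c d)) n)
    · rw [ite_mul, zero_mul]
    · rw [mul_assoc, ← expTwoPiI_add]
      congr 2
      push_cast
      ring
  have e3 : ∀ d : ℝ, ∑' i : (ℤ × ℤ) × (ℤ × ℤ), (if i.2.1 = x then if i.1.2 = n then
      if i.1.1 = m then g i else 0 else 0 else 0) * expTwoPiI (i.2.2 * d) = 0 := by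
    intro d
    refine Eq.trans (tsum_congr fun i => ?_) (tsum_fiber_eq_zero
      (hmul _ h2 fun i => i.2.2 * d) (fun i => i.2.1)
      (fun c => Eq.trans (tsum_congr fun i => ?_) (e2 c d)) x)
    · rw [ite_mul, zero_mul]
      push_cast
      rfl
    · rw [mul_assoc, ← expTwoPiI_add]
      congr 2
      push_cast
      ring
  have e4 := tsum_fiber_eq_zero h3 (fun i => i.2.2) e3 y
  rw [tsum_eq_single ((m, n), (x, y))] at e4
  · simpa using e4
  · rintro ⟨⟨m', n'⟩, ⟨x', y'⟩⟩ hne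
    split_ifs <;> simp_all

namespace HermitianModularForm

variable {k : ℤ} (f : HermitianModularForm (-3) k)

/-- The Fourier coefficients in the coordinates `((m, n), (x, y))`. -/
def coords (i : (ℤ × ℤ) × (ℤ × ℤ)) : ℂ := f.coeff (hermMatrix i)

lemma hasSum_coords {τ v₁ v₂ τ' : ℂ} (hZ : pointMatrix τ v₁ v₂ τ' ∈ HermitianUpperHalfSpace) :
    HasSum (fun i => f.coords i *
      expTwoPiI (i.1.1 * τ + i.1.2 * τ' + (i.2.1 * v₁ + i.2.2 * v₂)))
      (f.toFun (pointMatrix τ v₁ v₂ τ')) := by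
  have h := f.expansion _ hZ
  have h1 : HasSum (fun H => f.coeff H * expTwoPiI (H * pointMatrix τ v₁ v₂ τ').trace)
      (f.toFun (pointMatrix τ v₁ v₂ τ')) := by
    refine (hasSum_subtype_iff_of_support_subset (s := HermLattice (-3)) fun H hH => ?_).mp h
    exact f.coeff_supported H (left_ne_zero_of_mul hH)
  rw [← hermMatrix_injective.hasSum_iff] at h1
  · refine h1.congr_fun fun i => ?_
    rw [Function.comp_apply, trace_hermMatrix_mul_pointMatrix, coords]
  · intro H hH
    have : f.coeff H = 0 := by
      by_contra hne
      exact hH (exists_hermMatrix_eq (f.coeff_supported H hne).1)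
    rw [this, zero_mul]

lemma fourierSeries_coords {τ v₁ v₂ τ' : ℂ}
    (hZ : pointMatrix τ v₁ v₂ τ' ∈ HermitianUpperHalfSpace) :
    fourierSeries f.coords τ v₁ v₂ τ' = f.toFun (pointMatrix τ v₁ v₂ τ') :=
  (f.hasSum_coords hZ).tsum_eq

/-- An automorphism of the index lattice induced by a symmetry of `f` preserves the
coefficients. -/
lemma coords_comp_equiv (σ : (ℤ × ℤ) × (ℤ × ℤ) ≃ (ℤ × ℤ) × (ℤ × ℤ))
    (h : ∀ τ τ' : ℂ, ∀ v₁ v₂ : ℝ, 0 < τ.im → 0 < τ'.im → HasSum (fun i => f.coords i *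
      expTwoPiI ((σ i).1.1 * τ + (σ i).1.2 * τ' + ((σ i).2.1 * v₁ + (σ i).2.2 * v₂)))
      (f.toFun (pointMatrix τ v₁ v₂ τ'))) (i : (ℤ × ℤ) × (ℤ × ℤ)) :
    f.coords (σ i) = f.coords i := by
  let E : (ℤ × ℤ) × (ℤ × ℤ) → ℂ := fun i => expTwoPiI (i.1.1 * Complex.I + i.1.2 * Complex.I)
  have key : ∀ a b c d : ℝ, HasSum (fun i => (f.coords (σ.symm i) - f.coords i) * E i *
      expTwoPiI (i.1.1 * a + i.1.2 * b + (i.2.1 * c + i.2.2 * d))) 0 := by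
    intro a b c d
    have ha : 0 < (Complex.I + a).im := by simp
    have hb : 0 < (Complex.I + b).im := by simp
    have h1 := (σ.symm.hasSum_iff).mpr (h _ _ c d ha hb)
    have h2 := f.hasSum_coords (pointMatrix_ofReal_mem ha hb c d)
    have h3 := h1.sub h2
    rw [sub_self] at h3
    refine h3.congr_fun fun i => ?_
    simp only [Function.comp_apply, Equiv.apply_symm_apply, E]
    rw [← sub_mul, mul_assoc, ← expTwoPiI_add]
    congr 2
    ring
  have h0 := eq_zero_of_tsum_mul_expTwoPiI (g := fun i =>
      (f.coords (σ.symm i) - f.coords i) * E i)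
    (by simpa [expTwoPiI] using (key 0 0 0 0).summable) (fun a b c d => (key a b c d).tsum_eq)
  have hi := congr_fun h0 (σ i)
  simp only [Equiv.symm_apply_apply, Pi.zero_apply, mul_eq_zero, E, expTwoPiI_ne_zero,
    or_false] at hi
  exact (sub_eq_zero.mp hi).symm

lemma toFun_conj {U D : Matrix (Fin 2) (Fin 2) ℂ} (hU : ∀ i j, U i j ∈ ringInt (-3))
    (hD : ∀ i j, D i j ∈ ringInt (-3)) (hUD : Uᴴ * D = 1) {Z : Matrix (Fin 2) (Fin 2) ℂ}
    (hZ : Z ∈ HermitianUpperHalfSpace) :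
    f.toFun (U * Z * Uᴴ) = (U.det * D.det) ^ k * D.det ^ k * f.toFun Z := by
  have hDU : Dᴴ * U = 1 := by
    simpa using congrArg Matrix.conjTranspose hUD
  have h0 : (0 : ℂ) ∈ ringInt (-3) := ⟨0, 0, by simp⟩
  have hM : Matrix.fromBlocks U 0 0 D ∈ HermitianModularGroup (-3) := by
    refine ⟨?_, ?_⟩
    · rintro (i | i) (j | j)
      · exact hU i j
      · exact h0
      · exact h0
      · exact hD i j
    · simp [J2, Matrix.fromBlocks_conjTranspose, Matrix.fromBlocks_multiply, hUD, hDU]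
  have h := f.transform _ hM Z hZ
  simpa [matAct, nuChar, Matrix.inv_eq_left_inv hUD, Matrix.det_fromBlocks_zero₂₁] using h

lemma coords_shift (p q : ℤ) (hpq : p ^ 2 - p * q + q ^ 2 = 1) (m n x y : ℤ) :
    f.coords ((m, n + x * p + y * q + m), (x + m * (2 * p - q), y + m * (2 * q - p)))
      = f.coords ((m, n), (x, y)) := by
  have hpq' : (p ^ 2 - p * q + q ^ 2 : ℂ) = 1 := by exact_mod_cast hpq
  let σ : (ℤ × ℤ) × (ℤ × ℤ) ≃ (ℤ × ℤ) × (ℤ × ℤ) :=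
    { toFun := fun i => ((i.1.1, i.1.2 + i.2.1 * p + i.2.2 * q + i.1.1),
        (i.2.1 + i.1.1 * (2 * p - q), i.2.2 + i.1.1 * (2 * q - p)))
      invFun := fun i => ((i.1.1, i.1.2 - i.2.1 * p - i.2.2 * q + i.1.1),
        (i.2.1 - i.1.1 * (2 * p - q), i.2.2 - i.1.1 * (2 * q - p)))
      left_inv := by
        rintro ⟨⟨m, n⟩, ⟨x, y⟩⟩
        ext
        · rfl
        · dsimp only
          linear_combination -2 * m * hpq
        · simp
        · simp
      right_inv := by
        rintro ⟨⟨m, n⟩, ⟨x, y⟩⟩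
        ext
        · rfl
        · dsimp only
          linear_combination -2 * m * hpq
        · simp
        · simp }
  refine f.coords_comp_equiv σ (fun τ τ' v₁ v₂ hτ hτ' => ?_) ((m, n), (x, y))
  set μ : ℂ := p + q * ((-1 - sqrtD (-3)) / 2) with hμ
  have hμc : (starRingEnd ℂ) μ = p + q * ((-1 + sqrtD (-3)) / 2) := by
    simp only [hμ, map_add, map_mul, map_div₀, map_sub, map_neg, map_one, map_ofNat, map_intCast,
      conj_sqrtD]
    ring
  have hμμ : μ * (starRingEnd ℂ) μ = 1 := by
    rw [hμc, hμ]
    linear_combination (-q ^ 2 / 4 : ℂ) * sqrtD_neg_three_sq + hpq'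
  have h0 : (0 : ℂ) ∈ ringInt (-3) := ⟨0, 0, by simp⟩
  have h1 : (1 : ℂ) ∈ ringInt (-3) := ⟨1, 0, by simp⟩
  have hU : ∀ i j, !![1, μ; 0, 1] i j ∈ ringInt (-3) := by
    have : μ ∈ ringInt (-3) := ⟨p - 2 * q, -q, by rw [hμ]; push_cast; ring⟩
    intro i j
    fin_cases i <;> fin_cases j <;> assumption
  have hD : ∀ i j, !![1, 0; -(starRingEnd ℂ) μ, 1] i j ∈ ringInt (-3) := by
    have : -(starRingEnd ℂ) μ ∈ ringInt (-3) := ⟨-p - q, -q, by rw [hμc]; push_cast; ring⟩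
    intro i j
    fin_cases i <;> fin_cases j <;> assumption
  have hUD : !![1, μ; 0, 1]ᴴ * !![1, 0; -(starRingEnd ℂ) μ, 1] = 1 := by
    ext i j
    fin_cases i <;> fin_cases j <;> simp [Matrix.mul_apply, Fin.sum_univ_two]
  have htrans := f.toFun_conj hU hD hUD (pointMatrix_ofReal_mem hτ hτ' v₁ v₂)
  have hconj : !![1, μ; 0, 1] * pointMatrix τ v₁ v₂ τ' * !![1, μ; 0, 1]ᴴ
      = pointMatrix (τ + (2 * p - q) * v₁ + (2 * q - p) * v₂ + τ') (v₁ + p * τ') (v₂ + q * τ')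
        τ' := by
    ext i j
    fin_cases i <;> fin_cases j <;>
      simp only [pointMatrix, Matrix.mul_apply, Fin.sum_univ_two, Matrix.conjTranspose_apply,
        Matrix.of_apply, Matrix.cons_val', Matrix.cons_val_zero, Matrix.cons_val_one,
        Fin.zero_eta, Fin.mk_one, RCLike.star_def, map_one, map_zero, hμc]
    · rw [hμ]
      linear_combination (-q ^ 2 / 4 * τ' - q * v₂ / 2 : ℂ) * sqrtD_neg_three_sq + τ' * hpq'
    · rw [hμ]
      ring
    · ring
    · ring
  have hmem : pointMatrix (τ + (2 * p - q) * v₁ + (2 * q - p) * v₂ + τ') (v₁ + p * τ')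
      (v₂ + q * τ') τ' ∈ HermitianUpperHalfSpace := by
    have him : (τ + (2 * p - q) * v₁ + (2 * q - p) * v₂ + τ').im = τ.im + τ'.im := by
      simp
    refine pointMatrix_mem (by rw [him]; exact add_pos hτ hτ') ?_
    have hz : v₁ + p * τ' - (starRingEnd ℂ) (v₁ + p * τ') + (v₂ + q * τ'
        - (starRingEnd ℂ) (v₂ + q * τ')) * ((-1 - sqrtD (-3)) / 2)
        = μ * (τ' - (starRingEnd ℂ) τ') := by
      simp only [map_add, map_mul, Complex.conj_ofReal, map_intCast, hμ]
      ring
    have hn : Complex.normSq μ = 1 := by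
      rw [Complex.mul_conj] at hμμ
      exact_mod_cast hμμ
    rw [hz, him, Complex.normSq_mul, hn, Complex.sub_conj, Complex.normSq_mul, Complex.normSq_I,
      Complex.normSq_ofReal]
    nlinarith [mul_pos hτ hτ']
  rw [hconj] at htrans
  have hs := f.hasSum_coords hmem
  rw [htrans] at hs
  simp only [Matrix.det_fin_two_of, mul_one, mul_zero, zero_mul, sub_zero, _root_.one_zpow,
    one_mul] at hs
  refine hs.congr_fun fun i => ?_
  simp only [σ, Equiv.coe_fn_mk]
  congr 2
  push_cast
  ring

lemma coords_swap (hk : Even k) (m n x y : ℤ) :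
    f.coords ((m, n), (x, y)) = f.coords ((n, m), (x, -x - y)) := by
  let σ : (ℤ × ℤ) × (ℤ × ℤ) ≃ (ℤ × ℤ) × (ℤ × ℤ) :=
    { toFun := fun i => ((i.1.2, i.1.1), (i.2.1, -i.2.1 - i.2.2))
      invFun := fun i => ((i.1.2, i.1.1), (i.2.1, -i.2.1 - i.2.2))
      left_inv := fun i => by simp
      right_inv := fun i => by simp }
  refine (f.coords_comp_equiv σ (fun τ τ' v₁ v₂ hτ hτ' => ?_) ((m, n), (x, y))).symm
  have h0 : (0 : ℂ) ∈ ringInt (-3) := ⟨0, 0, by simp⟩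
  have h1 : (1 : ℂ) ∈ ringInt (-3) := ⟨1, 0, by simp⟩
  have hU : ∀ i j, (!![0, 1; 1, 0] : Matrix (Fin 2) (Fin 2) ℂ) i j ∈ ringInt (-3) := by
    intro i j
    fin_cases i <;> fin_cases j <;> assumption
  have hUU : (!![0, 1; 1, 0] : Matrix (Fin 2) (Fin 2) ℂ)ᴴ * !![0, 1; 1, 0] = 1 := by
    ext i j
    fin_cases i <;> fin_cases j <;> simp [Matrix.mul_apply, Fin.sum_univ_two]
  have htrans := f.toFun_conj hU hU hUU (pointMatrix_ofReal_mem hτ hτ' v₁ v₂)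
  have hconj : !![0, 1; 1, 0] * pointMatrix τ v₁ v₂ τ' * !![0, 1; 1, 0]ᴴ
      = pointMatrix τ' (v₁ - v₂ : ℝ) (-v₂ : ℝ) τ := by
    ext i j
    fin_cases i <;> fin_cases j <;>
      simp [pointMatrix, Matrix.mul_apply, Fin.sum_univ_two] <;> ring
  rw [hconj] at htrans
  have hs := f.hasSum_coords (pointMatrix_ofReal_mem hτ' hτ (v₁ - v₂) (-v₂))
  rw [htrans] at hs
  simp only [Matrix.det_fin_two_of, mul_one, mul_zero, zero_sub, mul_neg, neg_neg, _root_.one_zpow,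
    hk.neg_one_zpow, one_mul] at hs
  refine hs.congr_fun fun i => ?_
  simp only [σ, Equiv.coe_fn_mk]
  congr 2
  push_cast
  ring

lemma toFun_inversion (hk : Even k) {τ v₁ v₂ τ' : ℂ} (hτ : τ ≠ 0)
    (hZ : pointMatrix τ v₁ v₂ τ' ∈ HermitianUpperHalfSpace) :
    f.toFun (pointMatrix (-1 / τ) (v₁ / τ) (v₂ / τ) (τ' - (v₁ ^ 2 - v₁ * v₂ + v₂ ^ 2) / τ))
      = τ ^ k * f.toFun (pointMatrix τ v₁ v₂ τ') := by
  set M : Matrix (Fin 2 ⊕ Fin 2) (Fin 2 ⊕ Fin 2) ℂ :=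
    Matrix.fromBlocks !![0, 0; 0, 1] !![-1, 0; 0, 0] !![1, 0; 0, 0] !![0, 0; 0, 1] with hMdef
  have h0 : (0 : ℂ) ∈ ringInt (-3) := ⟨0, 0, by simp⟩
  have h1 : (1 : ℂ) ∈ ringInt (-3) := ⟨1, 0, by simp⟩
  have h2 : (-1 : ℂ) ∈ ringInt (-3) := ⟨-1, 0, by simp⟩
  have hM : M ∈ HermitianModularGroup (-3) := by
    refine ⟨?_, ?_⟩
    · rintro (i | i) (j | j) <;> fin_cases i <;> fin_cases j <;> assumption
    · rw [hMdef, J2, Matrix.fromBlocks_conjTranspose, Matrix.fromBlocks_multiply,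
        Matrix.fromBlocks_multiply]
      congr 1 <;> ext i j <;> fin_cases i <;> fin_cases j <;>
        simp [Matrix.mul_apply, Fin.sum_univ_two]
  have hdet : M.det ^ 2 = 1 := by
    have hMM : M * M = Matrix.fromBlocks !![-1, 0; 0, 1] 0 0 !![-1, 0; 0, 1] := by
      rw [hMdef, Matrix.fromBlocks_multiply]
      congr 1 <;> ext i j <;> fin_cases i <;> fin_cases j <;>
        simp
    rw [sq, ← Matrix.det_mul, hMM, Matrix.det_fromBlocks_zero₂₁, Matrix.det_fin_two_of]
    norm_num
  have hdetk : M.det ^ k = 1 := by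
    obtain ⟨l, rfl⟩ := hk
    rw [← two_mul, _root_.zpow_mul]
    norm_cast
    rw [hdet, _root_.one_zpow]
  have hden : M.toBlocks₂₁ * pointMatrix τ v₁ v₂ τ' + M.toBlocks₂₂
      = !![τ, v₁ + v₂ * ((-1 - sqrtD (-3)) / 2); 0, 1] := by
    ext i j
    fin_cases i <;> fin_cases j <;>
      simp [hMdef, pointMatrix]
  have hact : matAct M (pointMatrix τ v₁ v₂ τ')
      = pointMatrix (-1 / τ) (v₁ / τ) (v₂ / τ) (τ' - (v₁ ^ 2 - v₁ * v₂ + v₂ ^ 2) / τ) := by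
    have hinv : (!![τ, v₁ + v₂ * ((-1 - sqrtD (-3)) / 2); 0, 1])⁻¹
        = !![1 / τ, -(v₁ + v₂ * ((-1 - sqrtD (-3)) / 2)) / τ; 0, 1] := by
      refine Matrix.inv_eq_left_inv ?_
      ext i j
      fin_cases i <;> fin_cases j <;> simp [Matrix.mul_apply, Fin.sum_univ_two, hτ]
      field_simp
      ring
    have hnum : M.toBlocks₁₁ * pointMatrix τ v₁ v₂ τ' + M.toBlocks₁₂
        = !![-1, 0; v₁ + v₂ * ((-1 + sqrtD (-3)) / 2), τ'] := by
      ext i j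
      fin_cases i <;> fin_cases j <;>
        simp [hMdef, pointMatrix]
    rw [matAct, hden, hnum, hinv]
    ext i j
    fin_cases i <;> fin_cases j <;>
      simp only [pointMatrix, Matrix.mul_apply, Fin.sum_univ_two, Matrix.of_apply,
        Matrix.cons_val', Matrix.cons_val_zero, Matrix.cons_val_one, Fin.zero_eta, Fin.mk_one]
    · ring
    · ring
    · ring
    · linear_combination (v₂ ^ 2 / (4 * τ)) * sqrtD_neg_three_sq
  have h := f.transform M hM _ hZ
  rwa [hact, hden, nuChar, if_neg (by norm_num), hdetk, one_mul, Matrix.det_fin_two_of, mul_zero,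
    sub_zero, mul_one] at h

lemma hermitianCoeffs_coords (hk : Even k) : HermitianCoeffs f.coords k where
  support := by
    rintro ⟨⟨m, n⟩, ⟨x, y⟩⟩ hne
    obtain ⟨hm, hn, h⟩ := hermMatrix_posSemidef_bound (f.coeff_supported _ hne).2
    refine ⟨hm, hn, abs_le_of_sq_le_sq ?_ (add_nonneg hm hn),
      abs_le_of_sq_le_sq ?_ (add_nonneg hm hn)⟩
    · nlinarith [sq_nonneg (m - n), sq_nonneg (x + 2 * y)]
    · nlinarith [sq_nonneg (m - n), sq_nonneg (2 * x + y)]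
  summable := by
    intro ε hε
    have him : ((ε / (2 * Real.pi) : ℝ) * Complex.I : ℂ).im = ε / (2 * Real.pi) := by
      rw [Complex.im_ofReal_mul, Complex.I_im, mul_one]
    have hpos : 0 < ((ε / (2 * Real.pi) : ℝ) * Complex.I : ℂ).im := by
      rw [him]
      positivity
    refine (f.hasSum_coords (pointMatrix_ofReal_mem hpos hpos 0 0)).summable.norm.congr fun i => ?_
    rw [norm_mul, norm_expTwoPiI]
    congr 2
    simp only [Complex.add_im, Complex.mul_im, Complex.intCast_re, Complex.intCast_im,
      Complex.ofReal_re, Complex.ofReal_im, Complex.I_re, Complex.I_im]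
    field_simp
    ring
  shift := f.coords_shift
  swap := f.coords_swap hk
  inversion := by
    intro τ τ' v₁ v₂ hτ hτ'
    have hτ0 : τ ≠ 0 := fun h => hτ.ne' (by rw [h, Complex.zero_im])
    filter_upwards [eventually_pointMatrix_mem hτ hτ' v₁ v₂ 0,
      eventually_pointMatrix_mem (im_neg_one_div_pos hτ) hτ' (v₁ / τ) (v₂ / τ)
        (-(v₁ ^ 2 - v₁ * v₂ + v₂ ^ 2) / τ)] with t h1 h2
    rw [zero_mul, add_zero] at h1
    rw [f.fourierSeries_coords h1, f.fourierSeries_coords h2, ← f.toFun_inversion hk hτ0 h1]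
    congr 2 <;> ring

end HermitianModularForm

/-- **Vanishing criterion over ℚ(√-3)** (Corollary 1.2 (2), `K = ℚ(√-3)`).
If a symmetric Hermitian modular form of even weight `k` with rational Fourier
coefficients has `a_f([[m, α], [ᾱ, n]]) = 0` for all `0 ≤ m ≤ (5k+9)/45`,
`0 ≤ n ≤ (10k+3)/90`, `α ∈ D_K⁻¹` with `mn - N(α) ≥ 0`, then `f = 0`. -/
theorem vanishing_criterion_sqrt_neg_three
    (p : ℕ) (hp : Nat.Prime p) (hp5 : 5 ≤ p) (k : ℤ) (hk : Even k)
    (f : HermitianModularForm (-3) k) (hsym : IsSymmetricHMF f)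
    (hrat : ∀ H, ∃ q : ℚ, f.coeff H = (q : ℂ))
    (hvan : ∀ (m n : ℤ) (α : ℂ), α ∈ invDiff (-3) →
      0 ≤ m → 45 * m ≤ 5 * k + 9 → 0 ≤ n → 90 * n ≤ 10 * k + 3 →
      Complex.normSq α ≤ (m : ℝ) * (n : ℝ) →
      f.coeff !![(m : ℂ), α; (starRingEnd ℂ) α, (n : ℂ)] = 0) :
    (∀ Z ∈ HermitianUpperHalfSpace, f.toFun Z = 0) ∧ ∀ H, f.coeff H = 0 := by
  have key : ∀ H, f.coeff H = 0 := by
    have hcoords : f.coords = 0 := by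
      refine (f.hermitianCoeffs_coords hk).eq_zero_of_forall_le fun m n q hm hn => ?_
      by_contra hne
      obtain ⟨hm0, hn0, h⟩ := hermMatrix_posSemidef_bound (f.coeff_supported _ hne).2
      refine hne (hvan m n (offDiag q) (offDiag_mem_invDiff q) hm0 (by omega) hn0 (by omega) ?_)
      have h1 := offDiag_mul_conj q
      rw [Complex.mul_conj] at h1
      have h2 : Complex.normSq (offDiag q) = (q.1 ^ 2 + q.1 * q.2 + q.2 ^ 2 : ℝ) / 3 := by
        exact_mod_cast h1
      have h3 : (q.1 ^ 2 + q.1 * q.2 + q.2 ^ 2 : ℝ) ≤ 3 * (m * n) := by exact_mod_cast h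
      rw [h2]
      linarith
    intro H
    by_contra hne
    obtain ⟨i, rfl⟩ := exists_hermMatrix_eq (f.coeff_supported H hne).1
    exact hne (congr_fun hcoords i)
  refine ⟨fun Z hZ => (f.expansion Z hZ).unique ?_, key⟩
  simpa only [key, zero_mul] using hasSum_zero

end
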